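/- arXiv:1211.1528 — 3 statements merged into one kernel-verified Lean document; each statement's English description precedes it below -/
import Mathlib

section
/- (Averaging over great circles equals averaging over the sphere.) Let m ≥ 2 and let S = S^{m−1} be the unit sphere of ℝ^m with the uniform (normalized surface) probability measure σ. For g, h ∈ S with h ≠ ±g, set v(g,h) = (h − ⟨h,g⟩g)/‖h − ⟨h,g⟩g‖ and L_{g,h}(t) = g·cos t + v(g,h)·sin t for t ∈ [0,π] (the half great circle starting at g through h). Then for every measurable function q : S → [0,∞], ∫_{S×S} ( ∫_0^π q(L_{g,h}(t)) dt ) dσ(g)dσ(h) = π·∫_S q dσ. -/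
noncomputable section

open Metric MeasureTheory
open scoped RealInnerProductSpace ENNReal

/-- The uniform (normalized surface) probability measure on the unit sphere `S^{m-1}` of
`ℝ^m`, obtained by normalizing the projection of Lebesgue measure to the sphere. -/
def unifSphereR (m : ℕ) : Measure (sphere (0 : EuclideanSpace ℝ (Fin m)) 1) :=
  (((volume : Measure (EuclideanSpace ℝ (Fin m))).toSphere Set.univ)⁻¹) •
    (volume : Measure (EuclideanSpace ℝ (Fin m))).toSphere

/-- The half great circle `L_{g,h}(t) = g·cos t + v(g,h)·sin t`, `t ∈ [0,π]`, starting at `g`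
and passing through `h`, where `v(g,h)` is the unit vector in the direction
`h − ⟨h,g⟩g` (junk value `0` when `h = ±g`, a case of measure zero). -/
def greatArc {m : ℕ} (g h : EuclideanSpace ℝ (Fin m)) (t : ℝ) : EuclideanSpace ℝ (Fin m) :=
  Real.cos t • g + Real.sin t • (‖h - ⟪h, g⟫ • g‖⁻¹ • (h - ⟪h, g⟫ • g))

set_option maxHeartbeats 400000

/-- The orthogonal group. -/
abbrev OrthG (m : ℕ) := unitary (EuclideanSpace ℝ (Fin m) →L[ℝ] EuclideanSpace ℝ (Fin m))

instance clm_continuousStar (m : ℕ) :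
    ContinuousStar (EuclideanSpace ℝ (Fin m) →L[ℝ] EuclideanSpace ℝ (Fin m)) :=
  ⟨(ContinuousLinearMap.adjoint (𝕜 := ℝ) (E := EuclideanSpace ℝ (Fin m))
    (F := EuclideanSpace ℝ (Fin m))).continuous⟩

instance orthG_compact (m : ℕ) : CompactSpace (OrthG m) := by
  have : ProperSpace (EuclideanSpace ℝ (Fin m) →L[ℝ] EuclideanSpace ℝ (Fin m)) :=
    FiniteDimensional.proper ℝ _
  refine isCompact_iff_compactSpace.mp (Metric.isCompact_of_isClosed_isBounded isClosed_unitary ?_)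
  refine (Metric.isBounded_closedBall (x := 0) (r := 1)).subset ?_
  intro U hU
  rw [mem_closedBall_zero_iff]
  refine ContinuousLinearMap.opNorm_le_bound _ zero_le_one fun x => ?_
  rw [one_mul]
  exact ((Unitary.linearIsometryEquiv ⟨U, hU⟩).norm_map x).le

instance orthG_sc (m : ℕ) : SecondCountableTopology (OrthG m) := by
  have : ProperSpace (EuclideanSpace ℝ (Fin m) →L[ℝ] EuclideanSpace ℝ (Fin m)) :=
    FiniteDimensional.proper ℝ _
  infer_instance

/-- Haar probability measure on the orthogonal group. -/
def orthHaar (m : ℕ) : Measure (OrthG m) := Measure.haarMeasure ⊤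

instance orthHaar_left (m : ℕ) : (orthHaar m).IsMulLeftInvariant := by
  unfold orthHaar; infer_instance

instance orthHaar_prob (m : ℕ) : IsProbabilityMeasure (orthHaar m) := by
  refine ⟨?_⟩
  exact Measure.haarMeasure_self (K₀ := (⊤ : TopologicalSpace.PositiveCompacts (OrthG m)))

lemma orth_norm {m : ℕ} (U : OrthG m) (x : EuclideanSpace ℝ (Fin m)) :
    ‖U.1 x‖ = ‖x‖ := (Unitary.linearIsometryEquiv U).norm_map x

lemma orth_inner {m : ℕ} (U : OrthG m) (x y : EuclideanSpace ℝ (Fin m)) :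
    ⟪U.1 x, U.1 y⟫ = ⟪x, y⟫ := (Unitary.linearIsometryEquiv U).inner_map_map x y

lemma orth_trans {m : ℕ} (x y : EuclideanSpace ℝ (Fin m)) (h : ‖x‖ = ‖y‖) :
    ∃ V : OrthG m, V.1 x = y := by
  refine ⟨Unitary.linearIsometryEquiv.symm (Submodule.reflection (ℝ ∙ (x - y))ᗮ), ?_⟩
  exact Submodule.reflection_sub h

lemma orth_meas {m : ℕ} :
    Measurable fun p : OrthG m × EuclideanSpace ℝ (Fin m) => (p.1⁻¹).1 p.2 := by
  apply Continuous.measurable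
  have h1 : Continuous fun p : OrthG m × EuclideanSpace ℝ (Fin m) => (p.1⁻¹).1 :=
    continuous_subtype_val.comp (continuous_inv.comp continuous_fst)
  exact h1.clm_apply continuous_snd

lemma haar_avg_eq {m : ℕ} (q : EuclideanSpace ℝ (Fin m) → ℝ≥0∞)
    (x y : EuclideanSpace ℝ (Fin m)) (h : ‖x‖ = ‖y‖) :
    ∫⁻ U, q ((U⁻¹).1 y) ∂(orthHaar m) = ∫⁻ U, q ((U⁻¹).1 x) ∂(orthHaar m) := by
  obtain ⟨V, rfl⟩ := orth_trans x y h
  rw [← lintegral_mul_left_eq_self (μ := orthHaar m) (fun U => q ((U⁻¹).1 x)) V⁻¹]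
  refine lintegral_congr fun U => ?_
  rw [mul_inv_rev, inv_inv]
  rfl

lemma inv_avg_abs {E G Ω : Type*} [MeasurableSpace E] [MeasurableSpace G] [MeasurableSpace Ω]
    (μ : Measure G) [IsProbabilityMeasure μ] (ρ : Measure Ω) [IsProbabilityMeasure ρ]
    (a : G → E → E) (ha : Measurable fun p : G × E => a p.1 p.2)
    (q : E → ℝ≥0∞) (hq : Measurable q) (X : Ω → E) (hX : Measurable X) (c : ℝ≥0∞)
    (hc : ∀ᵐ ω ∂ρ, ∫⁻ U, q (a U (X ω)) ∂μ = c)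
    (hinv : ∀ U : G, ∫⁻ ω, q (a U (X ω)) ∂ρ = ∫⁻ ω, q (X ω) ∂ρ) :
    ∫⁻ ω, q (X ω) ∂ρ = c := by
  have h1 : Measurable fun p : G × Ω => (p.1, X p.2) :=
    measurable_fst.prodMk (hX.comp measurable_snd)
  have h2 : Measurable fun p : G × Ω => a p.1 (X p.2) := ha.comp h1
  have hmeas : Measurable fun p : G × Ω => q (a p.1 (X p.2)) := hq.comp h2
  calc ∫⁻ ω, q (X ω) ∂ρ = ∫⁻ _ : G, ∫⁻ ω, q (X ω) ∂ρ ∂μ := by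
        rw [lintegral_const, measure_univ, mul_one]
    _ = ∫⁻ U : G, ∫⁻ ω, q (a U (X ω)) ∂ρ ∂μ := lintegral_congr fun U => (hinv U).symm
    _ = ∫⁻ ω, ∫⁻ U : G, q (a U (X ω)) ∂μ ∂ρ :=
        lintegral_lintegral_swap (f := fun U ω => q (a U (X ω))) hmeas.aemeasurable
    _ = ∫⁻ ω, c ∂ρ := lintegral_congr_ae hc
    _ = c := by rw [lintegral_const, measure_univ, mul_one]

lemma inv_avg {m : ℕ} {Ω : Type*} [MeasurableSpace Ω] (ρ : Measure Ω) [IsProbabilityMeasure ρ]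
    (q : EuclideanSpace ℝ (Fin m) → ℝ≥0∞) (hq : Measurable q)
    (X : Ω → EuclideanSpace ℝ (Fin m)) (hX : Measurable X)
    (e : EuclideanSpace ℝ (Fin m)) (he : ‖e‖ = 1)
    (hn : ∀ᵐ ω ∂ρ, ‖X ω‖ = 1)
    (hinv : ∀ U : OrthG m, ∫⁻ ω, q (U.1 (X ω)) ∂ρ = ∫⁻ ω, q (X ω) ∂ρ) :
    ∫⁻ ω, q (X ω) ∂ρ = ∫⁻ U, q ((U⁻¹).1 e) ∂(orthHaar m) := by
  have hc : ∀ᵐ ω ∂ρ, ∫⁻ U : OrthG m, q ((U⁻¹).1 (X ω)) ∂(orthHaar m) =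
      ∫⁻ U, q ((U⁻¹).1 e) ∂(orthHaar m) := by
    filter_upwards [hn] with ω hω
    exact haar_avg_eq q e (X ω) (he.trans hω.symm)
  exact inv_avg_abs (orthHaar m) ρ (fun U x => (U⁻¹).1 x) orth_meas q hq X hX _ hc
    (fun U => hinv U⁻¹)

lemma greatArc_map {m : ℕ} (U : OrthG m) (g h : EuclideanSpace ℝ (Fin m)) (t : ℝ) :
    greatArc (U.1 g) (U.1 h) t = U.1 (greatArc g h t) := by
  unfold greatArc
  have h1 : U.1 h - ⟪U.1 h, U.1 g⟫ • U.1 g = U.1 (h - ⟪h, g⟫ • g) := by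
    rw [orth_inner, map_sub, map_smul]
  rw [h1, orth_norm]
  simp only [map_add, map_smul]

lemma greatArc_meas {m : ℕ} {Ω : Type*} [MeasurableSpace Ω]
    {A B : Ω → EuclideanSpace ℝ (Fin m)} {T : Ω → ℝ} (hA : Measurable A) (hB : Measurable B)
    (hT : Measurable T) : Measurable fun ω => greatArc (A ω) (B ω) (T ω) := by
  unfold greatArc
  have hi : Measurable fun ω => ⟪B ω, A ω⟫ := hB.inner hA
  have hia : Measurable fun ω => ⟪B ω, A ω⟫ • A ω := hi.smul hA
  have hw : Measurable fun ω => B ω - ⟪B ω, A ω⟫ • A ω := hB.sub hia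
  exact ((Real.measurable_cos.comp hT).smul hA).add
    ((Real.measurable_sin.comp hT).smul (hw.norm.inv.smul hw))

lemma greatArc_norm {m : ℕ} (g h : EuclideanSpace ℝ (Fin m)) (t : ℝ) (hg : ‖g‖ = 1)
    (hne : h - ⟪h, g⟫ • g ≠ 0) : ‖greatArc g h t‖ = 1 := by
  unfold greatArc
  set w := h - ⟪h, g⟫ • g with hw
  have ho : ⟪g, w⟫ = 0 := by
    rw [hw, inner_sub_right, inner_smul_right, real_inner_self_eq_norm_sq, hg,
      real_inner_comm g h]
    ring
  have hv : ‖‖w‖⁻¹ • w‖ = 1 := by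
    rw [norm_smul, norm_inv, norm_norm, inv_mul_cancel₀ (norm_ne_zero_iff.mpr hne)]
  have hov : ⟪g, ‖w‖⁻¹ • w⟫ = 0 := by rw [inner_smul_right, ho, mul_zero]
  have : ‖Real.cos t • g + Real.sin t • (‖w‖⁻¹ • w)‖ ^ 2 = 1 := by
    rw [norm_add_sq_real, inner_smul_left, inner_smul_right, hov, norm_smul, norm_smul, hv, hg]
    simp [sq_abs]
  nlinarith [norm_nonneg (Real.cos t • g + Real.sin t • (‖w‖⁻¹ • w))]

/-- the action on the sphere -/
def sphAct {m : ℕ} (U : OrthG m) (x : sphere (0 : EuclideanSpace ℝ (Fin m)) 1) :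
    sphere (0 : EuclideanSpace ℝ (Fin m)) 1 :=
  ⟨U.1 x.1, by rw [mem_sphere_zero_iff_norm, orth_norm]; exact mem_sphere_zero_iff_norm.mp x.2⟩

lemma sphAct_meas {m : ℕ} (U : OrthG m) : Measurable (sphAct U) :=
  ((U.1.continuous.comp continuous_subtype_val).subtype_mk _).measurable

lemma sphAct_toSphere {m : ℕ} (U : OrthG m) :
    MeasurePreserving (sphAct U) (volume : Measure (EuclideanSpace ℝ (Fin m))).toSphere
      (volume : Measure (EuclideanSpace ℝ (Fin m))).toSphere := by
  refine ⟨sphAct_meas U, ?_⟩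
  ext s hs
  rw [Measure.map_apply (sphAct_meas U) hs, Measure.toSphere_apply' _ hs,
    Measure.toSphere_apply' _ (sphAct_meas U hs)]
  congr 1
  refine Eq.trans ?_ ((Unitary.linearIsometryEquiv U).measurePreserving.measure_preimage_equiv
    (f := (Unitary.linearIsometryEquiv U).toMeasurableEquiv) _)
  congr 1
  have hU : ∀ y, (Unitary.linearIsometryEquiv U) y = U.1 y := fun y => rfl
  ext x
  simp only [Set.mem_smul, Set.mem_preimage, Set.mem_image]
  constructor
  · rintro ⟨r, hr, _, ⟨y, hy, rfl⟩, rfl⟩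
    refine ⟨r, hr, _, ⟨_, hy, rfl⟩, ?_⟩
    exact (U.1.map_smul r y.1).symm
  · rintro ⟨r, hr, _, ⟨y, hy, rfl⟩, hxy⟩
    have h1 : U.1 ((U⁻¹).1 y.1) = y.1 := by
      have : (U * U⁻¹).1 y.1 = y.1 := by rw [mul_inv_cancel]; rfl
      exact this
    refine ⟨r, hr, _, ⟨sphAct U⁻¹ y, ?_, rfl⟩, ?_⟩
    · have : sphAct U (sphAct U⁻¹ y) = y := Subtype.ext h1
      rw [this]; exact hy
    · apply (Unitary.linearIsometryEquiv U).injective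
      refine Eq.trans ?_ hxy
      refine (U.1.map_smul r _).trans ?_
      congr 1

lemma sphAct_unif {m : ℕ} (U : OrthG m) :
    MeasurePreserving (sphAct U) (unifSphereR m) (unifSphereR m) := by
  unfold unifSphereR
  exact (sphAct_toSphere U).smul_measure _

lemma unif_prob {m : ℕ} (hm : 2 ≤ m) : IsProbabilityMeasure (unifSphereR m) := by
  have : Nonempty (Fin m) := ⟨⟨0, by omega⟩⟩
  refine ⟨?_⟩
  unfold unifSphereR
  rw [Measure.smul_apply, smul_eq_mul]
  refine ENNReal.inv_mul_cancel ?_ (measure_ne_top _ _)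
  rw [Ne, Measure.measure_univ_eq_zero]
  exact Measure.toSphere_ne_zero _

lemma unif_null {m : ℕ} (hm : 2 ≤ m) (g : EuclideanSpace ℝ (Fin m)) :
    ∀ᵐ h ∂(unifSphereR m), h.1 - ⟪h.1, g⟫ • g ≠ 0 := by
  unfold unifSphereR
  refine Measure.ae_smul_measure ?_ _
  rw [ae_iff]
  have hms : MeasurableSet {h : sphere (0 : EuclideanSpace ℝ (Fin m)) 1 |
      ¬ (h.1 - ⟪h.1, g⟫ • g ≠ 0)} := by
    simp only [not_not]
    refine (isClosed_eq ?_ continuous_const).measurableSet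
    fun_prop
  rw [Measure.toSphere_apply' _ hms]
  refine mul_eq_zero.mpr (Or.inr ?_)
  refine measure_mono_null (t := ((ℝ ∙ g : Submodule ℝ _) : Set (EuclideanSpace ℝ (Fin m)))) ?_ ?_
  · rintro _ ⟨r, hr, _, ⟨y, hy, rfl⟩, rfl⟩
    have hy' : y.1 = ⟪y.1, g⟫ • g := by
      simpa [sub_eq_zero] using hy
    refine Submodule.smul_mem _ r ?_
    rw [hy']
    exact Submodule.smul_mem _ _ (Submodule.mem_span_singleton_self g)
  · refine Measure.addHaar_submodule _ _ fun htop => ?_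
    have h1 := finrank_span_le_card (R := ℝ) ({g} : Set (EuclideanSpace ℝ (Fin m)))
    rw [Set.toFinset_singleton, Finset.card_singleton, htop, finrank_top, finrank_euclideanSpace_fin] at h1
    omega


/-- **Averaging over great circles equals averaging over the sphere**: for every measurable
`q : S^{m−1} → [0,∞]`,
`∫_{S×S} (∫_0^π q(L_{g,h}(t)) dt) dσ(g)dσ(h) = π·∫_S q dσ`. -/
theorem average_over_great_circles {m : ℕ} (hm : 2 ≤ m)
    (q : EuclideanSpace ℝ (Fin m) → ℝ≥0∞) (hq : Measurable q) :
    ∫⁻ p : (sphere (0 : EuclideanSpace ℝ (Fin m)) 1) × (sphere (0 : EuclideanSpace ℝ (Fin m)) 1),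
        (∫⁻ t in Set.Icc (0 : ℝ) Real.pi, q (greatArc (p.1 : EuclideanSpace ℝ (Fin m)) (p.2 : EuclideanSpace ℝ (Fin m)) t))
        ∂((unifSphereR m).prod (unifSphereR m))
      = ENNReal.ofReal Real.pi *
          ∫⁻ x : sphere (0 : EuclideanSpace ℝ (Fin m)) 1, q (x : EuclideanSpace ℝ (Fin m))
            ∂(unifSphereR m) := by
  have := unif_prob hm
  have hmeas3 : Measurable fun p : ((sphere (0 : EuclideanSpace ℝ (Fin m)) 1) ×
      (sphere (0 : EuclideanSpace ℝ (Fin m)) 1)) × ℝ => greatArc p.1.1.1 p.1.2.1 p.2 :=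
    greatArc_meas (measurable_subtype_coe.comp (measurable_fst.comp measurable_fst))
      (measurable_subtype_coe.comp (measurable_snd.comp measurable_fst)) measurable_snd
  rw [lintegral_lintegral_swap (f := fun (p : (sphere (0 : EuclideanSpace ℝ (Fin m)) 1) ×
      (sphere (0 : EuclideanSpace ℝ (Fin m)) 1)) (t : ℝ) => q (greatArc p.1.1 p.2.1 t))
      (Measurable.aemeasurable (hq.comp hmeas3))]
  obtain ⟨e, he⟩ : ∃ e : EuclideanSpace ℝ (Fin m), ‖e‖ = 1 :=
    ⟨EuclideanSpace.single ⟨0, by omega⟩ 1, by simp⟩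
  have key : ∀ t : ℝ, ∫⁻ p : (sphere (0 : EuclideanSpace ℝ (Fin m)) 1) ×
      (sphere (0 : EuclideanSpace ℝ (Fin m)) 1), q (greatArc p.1.1 p.2.1 t)
        ∂((unifSphereR m).prod (unifSphereR m)) =
      ∫⁻ x : sphere (0 : EuclideanSpace ℝ (Fin m)) 1, q x.1 ∂(unifSphereR m) := by
    intro t
    have hmt : Measurable fun p : (sphere (0 : EuclideanSpace ℝ (Fin m)) 1) ×
      (sphere (0 : EuclideanSpace ℝ (Fin m)) 1) => greatArc p.1.1 p.2.1 t := by
      exact greatArc_meas (measurable_subtype_coe.comp measurable_fst)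
        (measurable_subtype_coe.comp measurable_snd) measurable_const
    have e1 : ∫⁻ x : sphere (0 : EuclideanSpace ℝ (Fin m)) 1, q x.1 ∂(unifSphereR m) =
        ∫⁻ U, q ((U⁻¹).1 e) ∂(orthHaar m) := by
      refine inv_avg (unifSphereR m) q hq (fun x => x.1) measurable_subtype_coe e he ?_ ?_
      · exact Filter.Eventually.of_forall fun x => mem_sphere_zero_iff_norm.mp x.2
      · intro U
        exact (sphAct_unif U).lintegral_comp (f := fun x => q x.1)
          (hq.comp measurable_subtype_coe)
    rw [e1]
    refine inv_avg ((unifSphereR m).prod (unifSphereR m)) q hq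
      (fun p => greatArc p.1.1 p.2.1 t) hmt e he ?_ ?_
    · have hs : MeasurableSet {p : (sphere (0 : EuclideanSpace ℝ (Fin m)) 1) ×
        (sphere (0 : EuclideanSpace ℝ (Fin m)) 1) | ‖greatArc p.1.1 p.2.1 t‖ = 1} :=
        hmt.norm (measurableSet_singleton 1)
      refine (Measure.ae_prod_iff_ae_ae hs).mpr ?_
      refine Filter.Eventually.of_forall fun g => ?_
      filter_upwards [unif_null hm g.1] with h hh
      exact greatArc_norm _ _ t (mem_sphere_zero_iff_norm.mp g.2) hh
    · intro U
      rw [← ((sphAct_unif U).prod (sphAct_unif U)).lintegral_comp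
        (f := fun p => q (greatArc p.1.1 p.2.1 t)) (hq.comp hmt)]
      refine lintegral_congr fun p => ?_
      exact congrArg q (greatArc_map U p.1.1 p.2.1 t).symm
  simp only [key]
  rw [setLIntegral_const, Real.volume_Icc, sub_zero, mul_comm]

end
end

section
/- (Bounds for the minimal logarithmic energy.) For each d ≥ 2 define C_d by m_d = d²/4 − (d·log d)/4 + C_d·d, i.e. C_d = (m_d − d²/4 + (d·log d)/4)/d. Then −0.4375 ≤ liminf_{d→∞} C_d and limsup_{d→∞} C_d ≤ −0.3700708. -/
noncomputable section

open Filter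

/-- `ℝ³` with its Euclidean structure. -/
abbrev E3 : Type := EuclideanSpace ℝ (Fin 3)

/-- The Riemann sphere `S(1/2) ⊂ ℝ³`: the sphere of radius `1/2` centered at `(0,0,1/2)`. -/
def riemannSphere : Set E3 :=
  Metric.sphere ((WithLp.equiv 2 (Fin 3 → ℝ)).symm ![0, 0, 1/2]) (1/2)

/-- The logarithmic energy `E(x_1,…,x_d) = −∑_{i<j} log‖x_i − x_j‖`. -/
def logEnergy {d : ℕ} (x : Fin d → E3) : ℝ :=
  -∑ p ∈ Finset.univ.filter (fun p : Fin d × Fin d => p.1 < p.2),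
      Real.log (dist (x p.1) (x p.2))

/-- The minimal logarithmic energy `m_d` of `d` (pairwise distinct) points on `S(1/2)`. -/
def minEnergy (d : ℕ) : ℝ :=
  sInf { e : ℝ | ∃ x : Fin d → E3,
    (∀ i, x i ∈ riemannSphere) ∧ Function.Injective x ∧ logEnergy x = e }

/-- The constant `C_d` defined by `m_d = d²/4 − (d·log d)/4 + C_d·d`. -/
def feketeC (d : ℕ) : ℝ :=
  (minEnergy d - (d : ℝ) ^ 2 / 4 + (d : ℝ) * Real.log d / 4) / d

/-- Welch-type inequality. -/
theorem welch_bound {d : ℕ} (a b : Fin d → ℂ) (h : ∀ i, ‖a i‖ ^ 2 + ‖b i‖ ^ 2 = 1) (k : ℕ) :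
    (d : ℝ) ^ 2 / (k + 1) ≤
      ∑ i, ∑ j, (‖a i * (starRingEnd ℂ) (a j) + b i * (starRingEnd ℂ) (b j)‖ ^ 2) ^ k := by
  let c : ℕ → ℝ := fun m => (k.choose m : ℝ)
  let v : Fin d → ℕ → ℂ := fun i m => a i ^ m * b i ^ (k - m)
  have key : ∑ i, ∑ j, (‖a i * (starRingEnd ℂ) (a j) + b i * (starRingEnd ℂ) (b j)‖ ^ 2) ^ k
      = ∑ m ∈ Finset.range (k + 1), ∑ l ∈ Finset.range (k + 1),
          c m * c l * ‖∑ i, v i m * (starRingEnd ℂ) (v i l)‖ ^ 2 := by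
    have hx : ∀ i j, (a i * (starRingEnd ℂ) (a j) + b i * (starRingEnd ℂ) (b j)) ^ k
        = ∑ m ∈ Finset.range (k + 1), (c m : ℂ) * (v i m * (starRingEnd ℂ) (v j m)) := by
      intro i j
      rw [add_pow]
      refine Finset.sum_congr rfl fun m _ => ?_
      simp only [c, v, map_mul, map_pow, mul_pow]
      push_cast
      ring
    apply Complex.ofReal_injective
    push_cast
    have e1 : ∀ i j, (((‖a i * (starRingEnd ℂ) (a j) + b i * (starRingEnd ℂ) (b j)‖ : ℝ) : ℂ) ^ 2) ^ k
        = ∑ m ∈ Finset.range (k + 1), ∑ l ∈ Finset.range (k + 1),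
          (c m : ℂ) * c l * ((v i m * (starRingEnd ℂ) (v i l)) *
            (starRingEnd ℂ) (v j m * (starRingEnd ℂ) (v j l))) := by
      intro i j
      rw [← Complex.mul_conj', mul_pow, ← map_pow, hx, map_sum, Finset.sum_mul_sum]
      refine Finset.sum_congr rfl fun m _ => Finset.sum_congr rfl fun l _ => ?_
      simp only [map_mul, Complex.conj_conj, Complex.conj_ofReal]
      ring
    simp_rw [e1]
    have e2 : ∀ m l, (((‖∑ i, v i m * (starRingEnd ℂ) (v i l)‖ : ℝ) : ℂ)) ^ 2
        = ∑ i, ∑ j, ((v i m * (starRingEnd ℂ) (v i l)) *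
            (starRingEnd ℂ) (v j m * (starRingEnd ℂ) (v j l))) := by
      intro m l
      rw [← Complex.mul_conj', map_sum, Finset.sum_mul_sum]
    simp_rw [e2, Finset.mul_sum]
    calc _ = ∑ i, ∑ m ∈ Finset.range (k + 1), ∑ j, ∑ l ∈ Finset.range (k + 1),
          (c m : ℂ) * c l * ((v i m * (starRingEnd ℂ) (v i l)) *
            (starRingEnd ℂ) (v j m * (starRingEnd ℂ) (v j l))) :=
            Finset.sum_congr rfl fun i _ => Finset.sum_comm
      _ = ∑ m ∈ Finset.range (k + 1), ∑ i, ∑ l ∈ Finset.range (k + 1), ∑ j,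
          (c m : ℂ) * c l * ((v i m * (starRingEnd ℂ) (v i l)) *
            (starRingEnd ℂ) (v j m * (starRingEnd ℂ) (v j l))) := by
            rw [Finset.sum_comm]
            exact Finset.sum_congr rfl fun m _ => Finset.sum_congr rfl fun i _ => Finset.sum_comm
      _ = _ := Finset.sum_congr rfl fun m _ => Finset.sum_comm
  rw [key]
  have hdiag : ∀ m ∈ Finset.range (k + 1), (c m * ∑ i, ‖v i m‖ ^ 2) ^ 2 ≤
      ∑ l ∈ Finset.range (k + 1), c m * c l * ‖∑ i, v i m * (starRingEnd ℂ) (v i l)‖ ^ 2 := by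
    intro m hm
    refine le_trans (le_of_eq ?_) (Finset.single_le_sum (f := fun l =>
      c m * c l * ‖∑ i, v i m * (starRingEnd ℂ) (v i l)‖ ^ 2) (fun l _ => by positivity) hm)
    have : ∑ i, v i m * (starRingEnd ℂ) (v i m) = ((∑ i, ‖v i m‖ ^ 2 : ℝ) : ℂ) := by
      push_cast
      exact Finset.sum_congr rfl fun i _ => Complex.mul_conj' _
    simp only [this, Complex.norm_real, Real.norm_eq_abs, sq_abs]
    ring
  refine le_trans ?_ (Finset.sum_le_sum hdiag)
  have htot : ∑ m ∈ Finset.range (k + 1), (c m * ∑ i, ‖v i m‖ ^ 2) = d := by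
    simp_rw [Finset.mul_sum]
    rw [Finset.sum_comm]
    have : ∀ i, ∑ m ∈ Finset.range (k + 1), c m * ‖v i m‖ ^ 2 = 1 := by
      intro i
      have := add_pow (‖a i‖ ^ 2) (‖b i‖ ^ 2) k
      rw [h i, one_pow] at this
      rw [this]
      refine Finset.sum_congr rfl fun m _ => ?_
      simp only [c, v, norm_mul, norm_pow]
      ring
    simp [this]
  have cs := sq_sum_le_card_mul_sum_sq (s := Finset.range (k + 1))
    (f := fun m => c m * ∑ i, ‖v i m‖ ^ 2)
  rw [htot, Finset.card_range] at cs
  rw [div_le_iff₀ (by positivity)]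
  push_cast at cs
  linarith

theorem sphere_eq (x : E3) (hx : x ∈ riemannSphere) :
    x 0 ^ 2 + x 1 ^ 2 = x 2 * (1 - x 2) := by
  simp only [riemannSphere, Metric.mem_sphere, EuclideanSpace.dist_eq, Fin.sum_univ_three,
    Real.dist_eq, sq_abs] at hx
  rw [Real.sqrt_eq_iff_mul_self_eq (by positivity) (by norm_num)] at hx
  simp [WithLp.equiv] at hx
  nlinarith

/-- Spinor coordinates. -/
theorem spinor_exists (x : E3) (hx : x ∈ riemannSphere) :
    ∃ a b : ℂ, ‖a‖ ^ 2 + ‖b‖ ^ 2 = 1 ∧ ‖b‖ ^ 2 = 1 - x 2 ∧ ‖a‖ ^ 2 = x 2 ∧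
      a * (starRingEnd ℂ) b = ⟨x 0, x 1⟩ := by
  have hs := sphere_eq x hx
  by_cases h1 : x 2 = 1
  · refine ⟨1, 0, by simp, by simp [h1], by simp [h1], ?_⟩
    rw [h1] at hs
    have h0 : x 0 = 0 := by nlinarith [sq_nonneg (x 0), sq_nonneg (x 1)]
    have h01 : x 1 = 0 := by nlinarith [sq_nonneg (x 0), sq_nonneg (x 1)]
    rw [h0, h01]
    apply Complex.ext <;> simp
  · have h2 : 0 < 1 - x 2 := by
      by_contra hcon
      have : 1 < x 2 := lt_of_le_of_ne (by linarith) (Ne.symm h1)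
      nlinarith [sq_nonneg (x 0), sq_nonneg (x 1)]
    set s := Real.sqrt (1 - x 2) with hsdef
    have hs2 : s ^ 2 = 1 - x 2 := Real.sq_sqrt h2.le
    have hs0 : 0 < s := Real.sqrt_pos.mpr h2
    have ha : ‖(⟨x 0 / s, x 1 / s⟩ : ℂ)‖ ^ 2 = x 2 := by
      rw [Complex.sq_norm, Complex.normSq_mk]
      field_simp
      nlinarith
    have hb : ‖(s : ℂ)‖ ^ 2 = 1 - x 2 := by
      rw [Complex.norm_real, Real.norm_eq_abs, sq_abs, hs2]
    refine ⟨⟨x 0 / s, x 1 / s⟩, s, by rw [ha, hb]; ring, hb, ha, ?_⟩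
    rw [Complex.conj_ofReal]
    apply Complex.ext <;> simp <;> field_simp

theorem spinor_dist (x y : E3) (a b a' b' : ℂ)
    (hx : x ∈ riemannSphere) (hy : y ∈ riemannSphere)
    (hb : ‖b‖ ^ 2 = 1 - x 2) (ha : ‖a‖ ^ 2 = x 2) (hab : a * (starRingEnd ℂ) b = ⟨x 0, x 1⟩)
    (hb' : ‖b'‖ ^ 2 = 1 - y 2) (ha' : ‖a'‖ ^ 2 = y 2)
    (hab' : a' * (starRingEnd ℂ) b' = ⟨y 0, y 1⟩) :
    ‖a * (starRingEnd ℂ) a' + b * (starRingEnd ℂ) b'‖ ^ 2 = 1 - dist x y ^ 2 := by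
  have h1 := sphere_eq x hx
  have h2 := sphere_eq y hy
  rw [EuclideanSpace.dist_eq, Real.sq_sqrt (by positivity)]
  simp only [Fin.sum_univ_three, Real.dist_eq, sq_abs]
  have hre := congrArg Complex.re hab
  have him := congrArg Complex.im hab
  have hre' := congrArg Complex.re hab'
  have him' := congrArg Complex.im hab'
  simp only [Complex.mul_re, Complex.mul_im, Complex.conj_re, Complex.conj_im] at hre him hre' him'
  have e : ‖a * (starRingEnd ℂ) a' + b * (starRingEnd ℂ) b'‖ ^ 2 =
      ‖a‖ ^ 2 * ‖a'‖ ^ 2 + ‖b‖ ^ 2 * ‖b'‖ ^ 2 + 2 * (x 0 * y 0 + x 1 * y 1) := by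
    rw [← hre, ← him, ← hre', ← him']
    simp only [Complex.sq_norm, Complex.normSq_apply, Complex.add_re, Complex.add_im,
      Complex.mul_re, Complex.mul_im, Complex.conj_re, Complex.conj_im]
    ring
  rw [e, ha, hb, ha', hb']
  linear_combination h1 + h2

theorem log_ge_truncated (w : ℝ) (h0 : 0 ≤ w) (h1 : w < 1) (n : ℕ) :
    ∑ k ∈ Finset.range n, w ^ (k + 1) / (k + 1) ≤ -Real.log (1 - w) := by
  have := Real.hasSum_pow_div_log_of_abs_lt_one (x := w) (by rwa [abs_of_nonneg h0])
  exact sum_le_hasSum _ (fun i _ => by positivity) this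

/-- The double-sum form of the energy. -/
theorem two_mul_logEnergy {d : ℕ} (x : Fin d → E3) :
    2 * logEnergy x = ∑ i, ∑ j, -Real.log (dist (x i) (x j)) := by
  unfold logEnergy
  rw [← Finset.sum_product' Finset.univ Finset.univ (fun i j => -Real.log (dist (x i) (x j)))]
  rw [Finset.univ_product_univ]
  have hsplit : ∀ p : Fin d × Fin d, -Real.log (dist (x p.1) (x p.2)) =
      (if p.1 < p.2 then -Real.log (dist (x p.1) (x p.2)) else 0) +
      (if p.2 < p.1 then -Real.log (dist (x p.1) (x p.2)) else 0) := by
    intro p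
    rcases lt_trichotomy p.1 p.2 with h | h | h
    · simp [h, h.not_gt]
    · simp [h]
    · simp [h, h.not_gt]
  rw [Finset.sum_congr rfl (fun p _ => hsplit p), Finset.sum_add_distrib]
  have hsym : ∑ p : Fin d × Fin d, (if p.2 < p.1 then -Real.log (dist (x p.1) (x p.2)) else 0)
      = ∑ p : Fin d × Fin d, (if p.1 < p.2 then -Real.log (dist (x p.1) (x p.2)) else 0) := by
    rw [← (Equiv.prodComm (Fin d) (Fin d)).sum_comp]
    refine Finset.sum_congr rfl fun p _ => ?_
    simp [dist_comm]
  rw [hsym, ← Finset.sum_filter, Finset.sum_neg_distrib]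
  ring

theorem energy_lower {d : ℕ} (x : Fin d → E3) (hx : ∀ i, x i ∈ riemannSphere)
    (hinj : Function.Injective x) :
    (d : ℝ) ^ 2 / 4 - d / 4 - d * (harmonic d : ℝ) / 4 ≤ logEnergy x := by
  choose a b hab1 hb ha hab using fun i => spinor_exists (x i) (hx i)
  set w : Fin d → Fin d → ℝ := fun i j => 1 - dist (x i) (x j) ^ 2 with hw
  have hwn : ∀ i j, ‖a i * (starRingEnd ℂ) (a j) + b i * (starRingEnd ℂ) (b j)‖ ^ 2 = w i j :=
    fun i j => spinor_dist _ _ _ _ _ _ (hx i) (hx j) (hb i) (ha i) (hab i) (hb j) (ha j) (hab j)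
  have hw0 : ∀ i j, 0 ≤ w i j := fun i j => by rw [← hwn]; positivity
  have hwelch : ∀ k : ℕ, (d : ℝ) ^ 2 / (k + 1) ≤ ∑ i, ∑ j, w i j ^ k := by
    intro k
    have := welch_bound a b hab1 k
    simpa only [hwn] using this
  have hterm : ∀ i j, ∑ k ∈ Finset.range d, w i j ^ (k + 1) / (k + 1)
      - (if i = j then (harmonic d : ℝ) else 0) ≤ 2 * (-Real.log (dist (x i) (x j))) := by
    intro i j
    by_cases h : i = j
    · subst h
      simp [hw, harmonic]
    · have hne : x i ≠ x j := fun e => h (hinj e)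
      have hd : 0 < dist (x i) (x j) := dist_pos.mpr hne
      have := log_ge_truncated (w i j) (hw0 i j) (by simp only [hw]; nlinarith) d
      rw [if_neg h, sub_zero]
      refine this.trans (le_of_eq ?_)
      simp only [hw, sub_sub_cancel, Real.log_pow]
      push_cast
      ring
  have hsum := Finset.sum_le_sum fun i (_ : i ∈ Finset.univ) =>
    Finset.sum_le_sum fun j (_ : j ∈ Finset.univ) => hterm i j
  simp only [← Finset.mul_sum, Finset.sum_sub_distrib, Finset.sum_ite_eq, Finset.mem_univ,
    if_true] at hsum
  rw [← two_mul_logEnergy] at hsum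
  have hswap : ∑ i, ∑ j, ∑ k ∈ Finset.range d, w i j ^ (k + 1) / ((k : ℝ) + 1) =
      ∑ k ∈ Finset.range d, (∑ i, ∑ j, w i j ^ (k + 1)) / ((k : ℝ) + 1) := by
    simp_rw [Finset.sum_div]
    rw [Finset.sum_comm]
    rw [Finset.sum_congr rfl fun i _ => Finset.sum_comm]
    rw [Finset.sum_comm]
    refine Finset.sum_congr rfl fun k _ => Finset.sum_comm
  have hlow : ∑ k ∈ Finset.range d, (d : ℝ) ^ 2 * (1 / ((k : ℝ) + 1) - 1 / ((k : ℝ) + 2)) ≤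
      ∑ k ∈ Finset.range d, (∑ i, ∑ j, w i j ^ (k + 1)) / ((k : ℝ) + 1) := by
    refine Finset.sum_le_sum fun k _ => ?_
    rw [le_div_iff₀ (by positivity)]
    refine le_trans (le_of_eq ?_) (hwelch (k + 1))
    push_cast
    field_simp
    ring
  have htel : ∀ n : ℕ, ∑ k ∈ Finset.range n, (1 / ((k : ℝ) + 1) - 1 / ((k : ℝ) + 2))
      = 1 - 1 / ((n : ℝ) + 1) := by
    intro n
    induction n with
    | zero => simp
    | succ n ih =>
      rw [Finset.sum_range_succ, ih]
      push_cast
      ring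
  rw [← Finset.mul_sum, htel] at hlow
  rw [hswap] at hsum
  simp only [Finset.sum_const, Finset.card_univ, Fintype.card_fin, nsmul_eq_mul] at hsum
  have hd : (d : ℝ) ^ 2 * (1 / ((d : ℝ) + 1)) ≤ d := by
    rw [mul_one_div, div_le_iff₀ (by positivity)]
    nlinarith [Nat.cast_nonneg (α := ℝ) d]
  nlinarith


/-! ### Upper bound: ring configurations -/

/-- Chordal distance in ring coordinates (height, phase). -/
def ringDist (p q : ℝ × ℂ) : ℝ :=
  ‖((√(p.1 * (1 - q.1)) : ℝ) : ℂ) * p.2 - ((√(q.1 * (1 - p.1)) : ℝ) : ℂ) * q.2‖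

theorem ringDist_comm (p q : ℝ × ℂ) : ringDist p q = ringDist q p := by
  unfold ringDist
  rw [← norm_neg, neg_sub]

/-- Twice the energy of a finite set of points in ring coordinates. -/
def ringEnergy (S T : Finset (ℝ × ℂ)) : ℝ := ∑ p ∈ S, ∑ q ∈ T, -Real.log (ringDist p q)

theorem ringEnergy_comm (S T : Finset (ℝ × ℂ)) : ringEnergy S T = ringEnergy T S := by
  unfold ringEnergy
  rw [Finset.sum_comm]
  simp_rw [ringDist_comm]

theorem ringEnergy_union (S R : Finset (ℝ × ℂ)) (h : Disjoint S R) :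
    ringEnergy (S ∪ R) (S ∪ R) = ringEnergy S S + ringEnergy R R + 2 * ringEnergy S R := by
  have e := ringEnergy_comm R S
  unfold ringEnergy at *
  rw [Finset.sum_union h]
  simp_rw [Finset.sum_union h, Finset.sum_add_distrib]
  rw [e]
  ring

theorem exists_rotation {ι : Type*} (s : Finset ι) (a : ι → ℂ) (ha : ∀ i ∈ s, ‖a i‖ < 1) :
    ∃ z : ℂ, ‖z‖ = 1 ∧ 0 ≤ ∑ i ∈ s, Real.log ‖z - a i‖ := by
  have hne : ∀ i ∈ s, ∀ z ∈ Metric.sphere (0 : ℂ) |(1 : ℝ)|, z - a i ≠ 0 := by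
    intro i hi z hz h0
    rw [abs_one, mem_sphere_zero_iff_norm] at hz
    have := ha i hi
    rw [← sub_eq_zero.mp h0, hz] at this
    exact lt_irrefl _ this
  have hcont : ContinuousOn (fun z : ℂ => ∑ i ∈ s, Real.log ‖z - a i‖)
      (Metric.sphere (0 : ℂ) |(1 : ℝ)|) := by
    refine continuousOn_finsetSum _ fun i hi => ?_
    refine ContinuousOn.log (by fun_prop) ?_
    intro z hz
    exact norm_ne_zero_iff.mpr (hne i hi z hz)
  obtain ⟨z, hz, hmax⟩ := (isCompact_sphere (0 : ℂ) |(1 : ℝ)|).exists_isMaxOn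
    ⟨1, by simp⟩ hcont
  refine ⟨z, by simpa using hz, ?_⟩
  have hCircInt : ∀ i ∈ s, CircleIntegrable (fun z : ℂ => Real.log ‖z - a i‖) 0 1 :=
    fun i _ => circleIntegrable_log_norm_sub_const 1
  have havg : Real.circleAverage (fun z : ℂ => ∑ i ∈ s, Real.log ‖z - a i‖) 0 1 = 0 := by
    rw [Real.circleAverage_fun_sum hCircInt]
    exact Finset.sum_eq_zero fun i hi => circleAverage_log_norm_sub_const₀ (ha i hi)
  rw [← havg]
  refine Real.circleAverage_mono_on_of_le_circle (CircleIntegrable.fun_sum s hCircInt) ?_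
  intro w hw
  exact hmax hw

theorem sum_periodic_shift (G : ℕ → ℝ) (r : ℕ) (hG : ∀ n, G (n + r) = G n) (c : ℕ) :
    ∑ l ∈ Finset.range r, G (l + c) = ∑ l ∈ Finset.range r, G l := by
  induction c with
  | zero => rfl
  | succ c ih =>
    rw [← ih]
    have h1 := Finset.sum_range_succ (fun l => G (l + c)) r
    have h2 := Finset.sum_range_succ' (fun l => G (l + c)) r
    have h3 : G (r + c) = G (0 + c) := by rw [add_comm r c, hG, zero_add]
    have h4 : ∀ l, G (l + (c + 1)) = G (l + 1 + c) := fun l => by congr 1; ring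
    simp_rw [h4]
    linarith

theorem ring_log_sum (r : ℕ) (hr : 1 ≤ r) (ζ : ℂ) (hζ : IsPrimitiveRoot ζ r) (k : ℕ) (hk : k < r)
    (ρ : ℝ) (hρ : 0 < ρ) :
    ∑ l ∈ Finset.range r, Real.log (ρ * ‖ζ ^ k - ζ ^ l‖) = Real.log r + (r - 1) * Real.log ρ := by
  have hn : ‖ζ‖ = 1 := hζ.norm'_eq_one (by omega)
  have hG : ∀ n, Real.log (ρ * ‖1 - ζ ^ (n + r)‖) = Real.log (ρ * ‖1 - ζ ^ n‖) := by
    intro n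
    rw [pow_add, hζ.pow_eq_one, mul_one]
  have h1 : ∀ l, ‖ζ ^ k - ζ ^ l‖ = ‖1 - ζ ^ (l + (r - k))‖ := by
    intro l
    have : ζ ^ k * (1 - ζ ^ (l + (r - k))) = ζ ^ k - ζ ^ l := by
      rw [mul_sub, mul_one, ← pow_add]
      have : k + (l + (r - k)) = l + r := by omega
      rw [this, pow_add, hζ.pow_eq_one, mul_one]
    rw [← this, norm_mul, norm_pow, hn, one_pow, one_mul]
  simp_rw [h1]
  rw [sum_periodic_shift (fun n => Real.log (ρ * ‖1 - ζ ^ n‖)) r hG (r - k)]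
  obtain ⟨n, rfl⟩ : ∃ n, r = n + 1 := ⟨r - 1, by omega⟩
  rw [Finset.sum_range_succ']
  have hne : ∀ l ∈ Finset.range n, ‖1 - ζ ^ (l + 1)‖ ≠ 0 := by
    intro l hl
    rw [Finset.mem_range] at hl
    rw [norm_ne_zero_iff, sub_ne_zero]
    exact (hζ.pow_ne_one_of_pos_of_lt (by omega) (by omega)).symm
  rw [Finset.sum_congr rfl fun l hl => Real.log_mul hρ.ne' (hne l hl), Finset.sum_add_distrib,
    ← Real.log_prod hne, ← norm_prod, hζ.prod_one_sub_pow_eq_order]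
  simp
  have : ‖(n : ℂ) + 1‖ = (n : ℝ) + 1 := by
    have := Complex.norm_natCast (n + 1)
    push_cast at this
    exact this
  rw [this]
  ring

theorem exists_ring (S : Finset (ℝ × ℂ)) (r : ℕ) (hr : 1 ≤ r) (h : ℝ) (h0 : 0 < h) (h1 : h < 1)
    (hS : ∀ p ∈ S, 0 < p.1 ∧ p.1 < h ∧ ‖p.2‖ = 1) :
    ∃ R : Finset (ℝ × ℂ), R.card = r ∧ (∀ p ∈ R, p.1 = h ∧ ‖p.2‖ = 1) ∧
      ringEnergy R R = -(r * (Real.log r + (r - 1) * ((Real.log h + Real.log (1 - h)) / 2))) ∧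
      ringEnergy S R ≤ -(r * ∑ p ∈ S, (Real.log h + Real.log (1 - p.1)) / 2) := by
  set ζ : ℂ := Complex.exp (2 * Real.pi * Complex.I / r) with hζdef
  have hζ : IsPrimitiveRoot ζ r := Complex.isPrimitiveRoot_exp r (by omega)
  have hζn : ‖ζ‖ = 1 := hζ.norm'_eq_one (by omega)
  have hζ0 : ζ ≠ 0 := norm_ne_zero_iff.mp (by rw [hζn]; exact one_ne_zero)
  let u : ℝ × ℂ → ℝ := fun p => √(p.1 * (1 - h))
  let v : ℝ × ℂ → ℝ := fun p => √(h * (1 - p.1))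
  have hv : ∀ p ∈ S, 0 < v p := fun p hp => by
    obtain ⟨a, b, c⟩ := hS p hp
    exact Real.sqrt_pos.mpr (mul_pos h0 (by linarith))
  have huv : ∀ p ∈ S, u p < v p := fun p hp => by
    obtain ⟨a, b, c⟩ := hS p hp
    exact Real.sqrt_lt_sqrt (mul_nonneg a.le (by linarith)) (by nlinarith)
  obtain ⟨z, hz, hsum⟩ := exists_rotation (S ×ˢ Finset.range r)
    (fun i => ((u i.1 / v i.1 : ℝ) : ℂ) * i.1.2 * (ζ ^ i.2)⁻¹) (by
      rintro ⟨p, k⟩ hi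
      rw [Finset.mem_product] at hi
      have hp := hi.1
      have := hv p hp
      simp only [norm_mul, norm_inv, norm_pow, hζn, one_pow, inv_one, mul_one, (hS p hp).2.2,
        Complex.norm_real, Real.norm_eq_abs]
      rw [abs_of_nonneg (div_nonneg (Real.sqrt_nonneg _) this.le), div_lt_one this]
      exact huv p hp)
  have hz0 : z ≠ 0 := norm_ne_zero_iff.mp (by rw [hz]; exact one_ne_zero)
  have hinj : Set.InjOn (fun k : ℕ => ((h, z * ζ ^ k) : ℝ × ℂ)) (Finset.range r) := by
    intro k hk l hl e
    have e2 := (Prod.mk.inj e).2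
    rw [Finset.coe_range] at hk hl
    exact hζ.pow_inj hk hl (mul_left_cancel₀ hz0 e2)
  refine ⟨(Finset.range r).image (fun k => (h, z * ζ ^ k)), ?_, ?_, ?_, ?_⟩
  · rw [Finset.card_image_of_injOn hinj, Finset.card_range]
  · intro p hp
    rw [Finset.mem_image] at hp
    obtain ⟨k, _, rfl⟩ := hp
    exact ⟨rfl, by simp [hz, hζn]⟩
  · unfold ringEnergy
    rw [Finset.sum_image hinj]
    have : ∀ k ∈ Finset.range r,
        ∑ q ∈ (Finset.range r).image (fun k => ((h, z * ζ ^ k) : ℝ × ℂ)),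
          -Real.log (ringDist (h, z * ζ ^ k) q)
        = -(Real.log r + (r - 1) * ((Real.log h + Real.log (1 - h)) / 2)) := by
      intro k hk
      rw [Finset.sum_image hinj, Finset.sum_neg_distrib]
      have hl : Real.log (√(h * (1 - h))) = (Real.log h + Real.log (1 - h)) / 2 := by
        rw [Real.log_sqrt (mul_nonneg h0.le (by linarith)),
          Real.log_mul h0.ne' (by linarith)]
      rw [← hl, ← ring_log_sum r hr ζ hζ k (Finset.mem_range.mp hk) _
        (Real.sqrt_pos.mpr (mul_pos h0 (by linarith)))]
      congr 1
      refine Finset.sum_congr rfl fun l _ => ?_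
      congr 1
      unfold ringDist
      simp only
      rw [← mul_sub, ← mul_sub, norm_mul, norm_mul, hz, one_mul, Complex.norm_real,
        Real.norm_eq_abs, abs_of_nonneg (Real.sqrt_nonneg _)]
    rw [Finset.sum_congr rfl this, Finset.sum_const, Finset.card_range, nsmul_eq_mul]
    ring
  · unfold ringEnergy
    have key : ∀ p ∈ S, ∀ k ∈ Finset.range r, -Real.log (ringDist p (h, z * ζ ^ k)) =
        -((Real.log h + Real.log (1 - p.1)) / 2) -
          Real.log ‖z - ((u p / v p : ℝ) : ℂ) * p.2 * (ζ ^ k)⁻¹‖ := by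
      intro p hp k hk
      have hvp := hv p hp
      have hvc : ((v p : ℝ) : ℂ) ≠ 0 := by exact_mod_cast hvp.ne'
      obtain ⟨a, b, c⟩ := hS p hp
      have e : ringDist p (h, z * ζ ^ k) =
          v p * ‖z - ((u p / v p : ℝ) : ℂ) * p.2 * (ζ ^ k)⁻¹‖ := by
        have : ((u p : ℝ) : ℂ) * p.2 - ((v p : ℝ) : ℂ) * (z * ζ ^ k) =
            -(((v p : ℝ) : ℂ) * ζ ^ k * (z - ((u p / v p : ℝ) : ℂ) * p.2 * (ζ ^ k)⁻¹)) := by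
          push_cast
          field_simp
          ring
        unfold ringDist
        change ‖((u p : ℝ) : ℂ) * p.2 - ((v p : ℝ) : ℂ) * (z * ζ ^ k)‖ = _
        rw [this, norm_neg, norm_mul, norm_mul, norm_pow, hζn, one_pow, mul_one,
          Complex.norm_real, Real.norm_eq_abs, abs_of_pos hvp]
      have hne : ‖z - ((u p / v p : ℝ) : ℂ) * p.2 * (ζ ^ k)⁻¹‖ ≠ 0 := by
        rw [norm_ne_zero_iff, sub_ne_zero]
        intro e
        have := congrArg norm e
        simp only [norm_mul, norm_inv, norm_pow, hζn, one_pow, inv_one, mul_one, c,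
          Complex.norm_real, Real.norm_eq_abs, hz] at this
        rw [abs_of_nonneg (div_nonneg (Real.sqrt_nonneg _) hvp.le)] at this
        have h2 := (div_lt_one hvp).mpr (huv p hp)
        linarith
      have hlv : Real.log (v p) = (Real.log h + Real.log (1 - p.1)) / 2 := by
        change Real.log (√(h * (1 - p.1))) = _
        rw [Real.log_sqrt (mul_nonneg h0.le (by linarith)),
          Real.log_mul h0.ne' (by linarith)]
      rw [e, Real.log_mul hvp.ne' hne, hlv]
      ring
    have : ∀ p ∈ S, ∑ q ∈ (Finset.range r).image (fun k => ((h, z * ζ ^ k) : ℝ × ℂ)),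
          -Real.log (ringDist p q) = -(r * ((Real.log h + Real.log (1 - p.1)) / 2)) -
          ∑ k ∈ Finset.range r, Real.log ‖z - ((u p / v p : ℝ) : ℂ) * p.2 * (ζ ^ k)⁻¹‖ := by
      intro p hp
      rw [Finset.sum_image hinj, Finset.sum_congr rfl (key p hp), Finset.sum_sub_distrib]
      simp
    rw [Finset.sum_congr rfl this, Finset.sum_sub_distrib, Finset.sum_neg_distrib,
      ← Finset.mul_sum]
    rw [Finset.sum_product] at hsum
    linarith

/-- Cost of the ring occupying the slots `B, …, B + r - 1` out of `d`. -/
def ringCost (d B r : ℕ) : ℝ :=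
  r * (-Real.log r + (Real.log ((B + r / 2) / d) + Real.log (1 - (B + r / 2) / d)) / 2
    - (B + r / 2) * Real.log ((B + r / 2) / d)
    - (d - (B + r / 2)) * Real.log (1 - (B + r / 2) / d))

/-- The quantity tracked while rings are added. -/
def ringQ (d : ℕ) (S : Finset (ℝ × ℂ)) : ℝ :=
  ringEnergy S S - (d - S.card) * ∑ p ∈ S, Real.log (1 - p.1)

theorem ring_step (d B r : ℕ) (hr : 1 ≤ r) (hBr : B + r ≤ d) (S : Finset (ℝ × ℂ))
    (hcard : S.card = B) (hS : ∀ p ∈ S, 0 < p.1 ∧ p.1 < (B : ℝ) / d ∧ ‖p.2‖ = 1) :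
    ∃ S' : Finset (ℝ × ℂ), S'.card = B + r ∧
      (∀ p ∈ S', 0 < p.1 ∧ p.1 < ((B + r : ℕ) : ℝ) / d ∧ ‖p.2‖ = 1) ∧
      ringQ d S' ≤ ringQ d S + ringCost d B r := by
  have hd : (0 : ℝ) < d := by exact_mod_cast (by omega : 0 < d)
  have hrR : (1 : ℝ) ≤ r := by exact_mod_cast hr
  have hBrR : (B : ℝ) + r ≤ d := by exact_mod_cast hBr
  have hB0 : (0 : ℝ) ≤ B := Nat.cast_nonneg _
  set h : ℝ := (B + r / 2) / d with hh
  have h0 : 0 < h := by positivity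
  have h1 : h < 1 := by rw [hh, div_lt_one hd]; linarith
  have hBh : (B : ℝ) / d < h := by rw [hh]; gcongr; linarith
  have hhr : h < ((B + r : ℕ) : ℝ) / d := by rw [hh]; push_cast; gcongr; linarith
  obtain ⟨R, hRc, hR, hRR, hSR⟩ := exists_ring S r hr h h0 h1
    (fun p hp => ⟨(hS p hp).1, (hS p hp).2.1.trans hBh, (hS p hp).2.2⟩)
  have hdisj : Disjoint S R := by
    rw [Finset.disjoint_left]
    intro p hp hp'
    have := (hS p hp).2.1
    rw [(hR p hp').1] at this
    linarith
  refine ⟨S ∪ R, by rw [Finset.card_union_of_disjoint hdisj, hcard, hRc], ?_, ?_⟩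
  · intro p hp
    rcases Finset.mem_union.mp hp with hp | hp
    · exact ⟨(hS p hp).1, ((hS p hp).2.1.trans hBh).trans hhr, (hS p hp).2.2⟩
    · rw [(hR p hp).1]
      exact ⟨h0, hhr, (hR p hp).2⟩
  · unfold ringQ
    rw [ringEnergy_union S R hdisj, hRR, Finset.card_union_of_disjoint hdisj, hcard, hRc,
      Finset.sum_union hdisj]
    have hLR : ∑ p ∈ R, Real.log (1 - p.1) = r * Real.log (1 - h) := by
      rw [Finset.sum_congr rfl fun p hp => by rw [(hR p hp).1]]
      simp [hRc]
    have hLS : ∑ p ∈ S, (Real.log h + Real.log (1 - p.1)) / 2 =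
        (B * Real.log h + ∑ p ∈ S, Real.log (1 - p.1)) / 2 := by
      rw [← Finset.sum_div, Finset.sum_add_distrib]
      simp [hcard]
    rw [hLR]
    rw [hLS] at hSR
    unfold ringCost
    rw [← hh]
    push_cast
    nlinarith

/-- Iterating the ring step along a potential. -/
theorem rings_of_potential (d : ℕ) (W : ℕ → ℝ)
    (hW : ∀ B < d, ∃ r, 1 ≤ r ∧ B + r ≤ d ∧ ringCost d B r ≤ W (B + r) - W B) :
    ∃ S : Finset (ℝ × ℂ), S.card = d ∧ (∀ p ∈ S, 0 < p.1 ∧ p.1 < 1 ∧ ‖p.2‖ = 1) ∧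
      ringEnergy S S ≤ W d - W 0 := by
  have key : ∀ n B : ℕ, d - B = n → B ≤ d → ∀ S : Finset (ℝ × ℂ), S.card = B →
      (∀ p ∈ S, 0 < p.1 ∧ p.1 < (B : ℝ) / d ∧ ‖p.2‖ = 1) →
      ∃ S' : Finset (ℝ × ℂ), S'.card = d ∧
        (∀ p ∈ S', 0 < p.1 ∧ p.1 < (d : ℝ) / d ∧ ‖p.2‖ = 1) ∧
        ringQ d S' ≤ ringQ d S + (W d - W B) := by
    intro n
    induction n using Nat.strong_induction_on with
    | _ n ih =>
      intro B hn hB S hc hS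
      rcases hB.eq_or_lt with rfl | hlt
      · exact ⟨S, hc, hS, by simp⟩
      · obtain ⟨r, hr, hBr, hcost⟩ := hW B hlt
        obtain ⟨S1, hc1, hS1, hQ1⟩ := ring_step d B r hr hBr S hc hS
        obtain ⟨S2, hc2, hS2, hQ2⟩ := ih (d - (B + r)) (by omega) (B + r) rfl hBr S1 hc1 hS1
        exact ⟨S2, hc2, hS2, by linarith⟩
  obtain ⟨S, hc, hS, hQ⟩ := key d 0 (by omega) (by omega) ∅ (by simp) (by simp)
  refine ⟨S, hc, fun p hp => ⟨(hS p hp).1, ?_, (hS p hp).2.2⟩, ?_⟩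
  · have := (hS p hp).2.1
    have hd : d ≠ 0 := by
      rintro rfl
      rw [Finset.card_eq_zero] at hc
      simp [hc] at hp
    rwa [div_self (by exact_mod_cast hd)] at this
  · unfold ringQ at hQ
    rw [hc] at hQ
    simpa [ringEnergy] using hQ

/-- Realization of ring coordinates on the sphere. -/
def ringPoint (p : ℝ × ℂ) : E3 :=
  !₂[√(p.1 * (1 - p.1)) * p.2.re, √(p.1 * (1 - p.1)) * p.2.im, p.1]

theorem ringPoint_mem (p : ℝ × ℂ) (h0 : 0 < p.1) (h1 : p.1 < 1) (hp : ‖p.2‖ = 1) :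
    ringPoint p ∈ riemannSphere := by
  have hn : p.2.re ^ 2 + p.2.im ^ 2 = 1 := by
    have := Complex.sq_norm p.2
    rw [hp, Complex.normSq_apply] at this
    linarith
  have hs := Real.sq_sqrt (mul_nonneg h0.le (sub_nonneg.mpr h1.le))
  simp only [riemannSphere, Metric.mem_sphere, EuclideanSpace.dist_eq, Fin.sum_univ_three,
    Real.dist_eq, sq_abs]
  rw [Real.sqrt_eq_iff_mul_self_eq (by positivity) (by norm_num)]
  simp [WithLp.equiv, ringPoint]
  rw [mul_pow, mul_pow, hs]
  linear_combination (p.1 * (1 - p.1)) * hn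

theorem ringPoint_dist (p q : ℝ × ℂ) (h0 : 0 < p.1) (h1 : p.1 < 1) (hp : ‖p.2‖ = 1)
    (g0 : 0 < q.1) (g1 : q.1 < 1) (hq : ‖q.2‖ = 1) :
    dist (ringPoint p) (ringPoint q) = ringDist p q := by
  have hn : p.2.re ^ 2 + p.2.im ^ 2 = 1 := by
    have := Complex.sq_norm p.2
    rw [hp, Complex.normSq_apply] at this
    linarith
  have gn : q.2.re ^ 2 + q.2.im ^ 2 = 1 := by
    have := Complex.sq_norm q.2
    rw [hq, Complex.normSq_apply] at this
    linarith
  have k1 : 0 < 1 - p.1 := by linarith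
  have k2 : 0 < 1 - q.1 := by linarith
  have hnn : 0 ≤ ringDist p q := norm_nonneg _
  rw [← sq_eq_sq₀ dist_nonneg hnn]
  unfold ringDist
  rw [EuclideanSpace.dist_eq, Real.sq_sqrt (by positivity), Complex.sq_norm, Complex.normSq_apply]
  simp only [Fin.sum_univ_three, Real.dist_eq, sq_abs]
  simp [ringPoint]
  rw [Real.sqrt_mul h0.le, Real.sqrt_mul h0.le, Real.sqrt_mul g0.le, Real.sqrt_mul g0.le]
  have s1 := Real.sq_sqrt h0.le
  have s2 := Real.sq_sqrt k1.le
  have s3 := Real.sq_sqrt g0.le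
  have s4 := Real.sq_sqrt k2.le
  generalize √p.1 = A at *
  generalize √(1 - p.1) = A' at *
  generalize √q.1 = C at *
  generalize √(1 - q.1) = C' at *
  have t1 : A ^ 2 + A' ^ 2 = 1 := by linarith
  have t2 : C ^ 2 + C' ^ 2 = 1 := by linarith
  rw [← s1, ← s3]
  have e1 : A' ^ 2 = 1 - A ^ 2 := by linarith
  have e2 : C' ^ 2 = 1 - C ^ 2 := by linarith
  have m1 : p.2.im ^ 2 = 1 - p.2.re ^ 2 := by linarith
  have m2 : q.2.im ^ 2 = 1 - q.2.re ^ 2 := by linarith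
  ring_nf
  simp only [e1, e2, m1, m2]
  ring

theorem exists_of_rings (d : ℕ) (S : Finset (ℝ × ℂ)) (hc : S.card = d)
    (hS : ∀ p ∈ S, 0 < p.1 ∧ p.1 < 1 ∧ ‖p.2‖ = 1) :
    ∃ x : Fin d → E3, (∀ i, x i ∈ riemannSphere) ∧ Function.Injective x ∧
      2 * logEnergy x = ringEnergy S S := by
  let e : Fin d ≃ S := (S.equivFinOfCardEq hc).symm
  have hv : ∀ i, 0 < (e i).1.1 ∧ (e i).1.1 < 1 ∧ ‖(e i).1.2‖ = 1 := fun i => hS _ (e i).2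
  refine ⟨fun i => ringPoint (e i), fun i => ringPoint_mem _ (hv i).1 (hv i).2.1 (hv i).2.2, ?_, ?_⟩
  · intro i j hij
    apply e.injective
    apply Subtype.ext
    have c : ∀ k : Fin 3, ringPoint (e i) k = ringPoint (e j) k := fun k => by
      simp only at hij
      rw [hij]
    have c0 := c 0
    have c1 := c 1
    have c2 := c 2
    simp [ringPoint] at c0 c1 c2
    rw [← c2] at c0 c1
    have hs : √((e i).1.1 * (1 - (e i).1.1)) ≠ 0 :=
      (Real.sqrt_pos.mpr (mul_pos (hv i).1 (by linarith [(hv i).2.1]))).ne'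
    refine Prod.ext c2 (Complex.ext ?_ ?_)
    · exact mul_left_cancel₀ hs (by simpa using c0)
    · exact mul_left_cancel₀ hs (by simpa using c1)
  · rw [two_mul_logEnergy]
    unfold ringEnergy
    rw [← Finset.sum_coe_sort S, ← e.sum_comp]
    refine Finset.sum_congr rfl fun i _ => ?_
    rw [← Finset.sum_coe_sort S, ← e.sum_comp]
    refine Finset.sum_congr rfl fun j _ => ?_
    rw [ringPoint_dist _ _ (hv i).1 (hv i).2.1 (hv i).2.2 (hv j).1 (hv j).2.1 (hv j).2.2]

/-! ### Upper bound: estimates -/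

theorem log_one_add_le_cubic (x : ℝ) (hx : 0 ≤ x) :
    Real.log (1 + x) ≤ x - x ^ 2 / 2 + x ^ 3 / 3 := by
  have hmono : MonotoneOn (fun y : ℝ => y - y ^ 2 / 2 + y ^ 3 / 3 - Real.log (1 + y))
      (Set.Ici 0) := by
    have hder : ∀ y : ℝ, 0 ≤ y → HasDerivAt
        (fun y : ℝ => y - y ^ 2 / 2 + y ^ 3 / 3 - Real.log (1 + y))
        (1 - (2 * y) / 2 + (3 * y ^ 2) / 3 - 1 / (1 + y)) y := by
      intro y hy
      have h1 : HasDerivAt (fun y : ℝ => y) 1 y := hasDerivAt_id y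
      have h2 : HasDerivAt (fun y : ℝ => y ^ 2 / 2) (2 * y / 2) y := by
        simpa using (hasDerivAt_pow 2 y).div_const 2
      have h3 : HasDerivAt (fun y : ℝ => y ^ 3 / 3) (3 * y ^ 2 / 3) y := by
        simpa using (hasDerivAt_pow 3 y).div_const 3
      have h4 : HasDerivAt (fun y : ℝ => Real.log (1 + y)) (1 / (1 + y)) y :=
        (h1.const_add 1).log (by positivity)
      exact ((h1.sub h2).add h3).sub h4
    refine monotoneOn_of_deriv_nonneg (convex_Ici 0)
      (fun y hy => (hder y hy).continuousAt.continuousWithinAt) ?_ ?_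
    · intro y hy
      rw [interior_Ici] at hy
      exact (hder y (le_of_lt hy)).differentiableAt.differentiableWithinAt
    · intro y hy
      rw [interior_Ici] at hy
      have hy0 : 0 < y := hy
      rw [(hder y hy0.le).deriv]
      have : 1 - (2 * y) / 2 + (3 * y ^ 2) / 3 - 1 / (1 + y) = y ^ 3 / (1 + y) := by
        field_simp
        ring
      rw [this]
      positivity
  have := hmono (Set.mem_Ici.mpr le_rfl) (Set.mem_Ici.mpr hx) hx
  simp at this
  linarith

/-- Antiderivative of `y log y`. -/
def yLogInt (y : ℝ) : ℝ := y * (y * Real.log y) / 2 - y ^ 2 / 4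

theorem yLogInt_continuous : Continuous yLogInt := by
  unfold yLogInt
  have := Real.continuous_mul_log
  fun_prop

theorem yLogInt_hasDerivAt (y : ℝ) (hy : 0 < y) : HasDerivAt yLogInt (y * Real.log y) y := by
  have h1 : HasDerivAt (fun y : ℝ => y) 1 y := hasDerivAt_id y
  have h2 := (h1.mul (h1.mul (Real.hasDerivAt_log hy.ne'))).div_const 2
  have h3 := (hasDerivAt_pow 2 y).div_const 4
  refine (h2.sub h3).congr_deriv ?_
  simp
  field_simp
  ring

theorem yLogInt_diff_le (δ : ℝ) (h0 : 0 ≤ δ) (h1 : δ ≤ 1) :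
    yLogInt (1 + δ) - yLogInt (1 - δ) ≤ δ ^ 3 / 3 + 2 * δ ^ 5 / 15 := by
  have hmono : MonotoneOn
      (fun t : ℝ => t ^ 3 / 3 + 2 * t ^ 5 / 15 - (yLogInt (1 + t) - yLogInt (1 - t)))
      (Set.Icc 0 1) := by
    have hder : ∀ t : ℝ, 0 < t → t < 1 → HasDerivAt
        (fun t : ℝ => t ^ 3 / 3 + 2 * t ^ 5 / 15 - (yLogInt (1 + t) - yLogInt (1 - t)))
        (3 * t ^ 2 / 3 + 2 * (5 * t ^ 4) / 15 -
          ((1 + t) * Real.log (1 + t) * 1 - (1 - t) * Real.log (1 - t) * (-1))) t := by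
      intro t ht ht1
      have h3 : HasDerivAt (fun y : ℝ => y ^ 3 / 3) (3 * t ^ 2 / 3) t := by
        simpa using (hasDerivAt_pow 3 t).div_const 3
      have h5 : HasDerivAt (fun y : ℝ => 2 * y ^ 5 / 15) (2 * (5 * t ^ 4) / 15) t := by
        simpa using ((hasDerivAt_pow 5 t).const_mul 2).div_const 15
      have hi : HasDerivAt (fun y : ℝ => y) 1 t := hasDerivAt_id t
      have ha : HasDerivAt (fun y : ℝ => yLogInt (1 + y)) ((1 + t) * Real.log (1 + t) * 1) t :=
        HasDerivAt.comp t (yLogInt_hasDerivAt (1 + t) (by linarith)) (hi.const_add 1)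
      have hb : HasDerivAt (fun y : ℝ => yLogInt (1 - y)) ((1 - t) * Real.log (1 - t) * (-1)) t :=
        HasDerivAt.comp t (yLogInt_hasDerivAt (1 - t) (by linarith)) (hi.const_sub 1)
      exact (h3.add h5).sub (ha.sub hb)
    refine monotoneOn_of_deriv_nonneg (convex_Icc 0 1) ?_ ?_ ?_
    · have := yLogInt_continuous
      fun_prop
    · intro t ht
      rw [interior_Icc] at ht
      exact (hder t ht.1 ht.2).differentiableAt.differentiableWithinAt
    · intro t ht
      rw [interior_Icc] at ht
      rw [(hder t ht.1 ht.2).deriv]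
      have a1 := log_one_add_le_cubic t ht.1.le
      have a2 := log_ge_truncated t ht.1.le ht.2 3
      simp [Finset.sum_range_succ] at a2
      have b1 := mul_le_mul_of_nonneg_left a1 (by linarith [ht.1] : 0 ≤ 1 + t)
      have b2 := mul_le_mul_of_nonneg_left a2 (by linarith [ht.2] : 0 ≤ 1 - t)
      ring_nf at b1 b2 ⊢
      linarith
  have := hmono (Set.left_mem_Icc.mpr zero_le_one) (Set.mem_Icc.mpr ⟨h0, h1⟩) h0
  simp at this
  linarith

theorem yLogInt_scale (c y : ℝ) (hc : 0 < c) (hy : 0 ≤ y) :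
    yLogInt (c * y) = c ^ 2 * yLogInt y + c ^ 2 * y ^ 2 / 2 * Real.log c := by
  rcases hy.eq_or_lt with rfl | hy
  · simp [yLogInt]
  · unfold yLogInt
    rw [Real.log_mul hc.ne' hy.ne']
    ring

theorem cell_bound (d N r η : ℝ) (hd : 0 < d) (hN : 0 < N) (hr : 0 ≤ r) (hr2 : r ≤ 2 * N)
    (hη : r ≤ 2 * η * N) :
    d ^ 2 * (yLogInt ((N + r / 2) / d) - yLogInt ((N - r / 2) / d)) - N * r * Real.log (N / d) ≤
      r ^ 3 / (24 * N) * (1 + 2 / 5 * η ^ 2) := by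
  set δ := r / (2 * N) with hδ
  have h0 : 0 ≤ δ := by positivity
  have h1 : δ ≤ 1 := by rw [hδ, div_le_one (by positivity)]; exact hr2
  have hδη : δ ≤ η := by rw [hδ, div_le_iff₀ (by positivity)]; linarith
  have hrδ : r = 2 * N * δ := by rw [hδ]; field_simp
  have e1 : (N + r / 2) / d = N / d * (1 + δ) := by rw [hrδ]; field_simp
  have e2 : (N - r / 2) / d = N / d * (1 - δ) := by rw [hrδ]; field_simp
  rw [e1, e2, yLogInt_scale _ _ (by positivity) (by linarith),
    yLogInt_scale _ _ (by positivity) (by linarith)]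
  have hJ := yLogInt_diff_le δ h0 h1
  have e3 : d ^ 2 * ((N / d) ^ 2 * yLogInt (1 + δ) + (N / d) ^ 2 * (1 + δ) ^ 2 / 2 * Real.log (N / d)
      - ((N / d) ^ 2 * yLogInt (1 - δ) + (N / d) ^ 2 * (1 - δ) ^ 2 / 2 * Real.log (N / d)))
      - N * r * Real.log (N / d) = N ^ 2 * (yLogInt (1 + δ) - yLogInt (1 - δ)) := by
    rw [hrδ]
    generalize Real.log (N / d) = L
    field_simp
    ring
  rw [e3]
  have e4 : r ^ 3 / (24 * N) * (1 + 2 / 5 * η ^ 2) = N ^ 2 * (δ ^ 3 / 3 * (1 + 2 / 5 * η ^ 2)) := by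
    rw [hrδ]
    field_simp
    ring
  rw [e4]
  refine mul_le_mul_of_nonneg_left (hJ.trans ?_) (by positivity)
  have : δ ^ 3 / 3 + 2 * δ ^ 5 / 15 = δ ^ 3 / 3 * (1 + 2 / 5 * δ ^ 2) := by ring
  rw [this]
  gcongr

/-- The main part of the potential. -/
def mainPot (d : ℕ) (B : ℝ) : ℝ := (d : ℝ) ^ 2 * (-yLogInt (B / d) + yLogInt (1 - B / d))

theorem cost_bound (d B r : ℕ) (hr : 1 ≤ r) (hBr : B + r ≤ d) (η N M : ℝ)
    (hN : N = B + r / 2) (hM : M = d - N)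
    (h1 : (r : ℝ) ≤ 2 * η * N) (h2 : (r : ℝ) ≤ 2 * η * M) :
    ringCost d B r ≤ mainPot d (B + r) - mainPot d B - r / 2 * Real.log d +
      r / 2 * (-Real.log (r ^ 2 * d / (N * M)) +
        r ^ 2 * d / (N * M) / 12 * (1 + 2 / 5 * η ^ 2)) := by
  have hd : (0 : ℝ) < d := by exact_mod_cast (by omega : 0 < d)
  have hrR : (1 : ℝ) ≤ r := by exact_mod_cast hr
  have hr0 : (0 : ℝ) < r := by linarith
  have hBrR : (B : ℝ) + r ≤ d := by exact_mod_cast hBr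
  have hB0 : (0 : ℝ) ≤ B := Nat.cast_nonneg _
  have hN0 : 0 < N := by rw [hN]; positivity
  have hM0 : 0 < M := by rw [hM, hN]; linarith
  have c1 := cell_bound d N r η hd hN0 hr0.le (by rw [hN]; linarith) h1
  have c2 := cell_bound d M r η hd hM0 hr0.le (by rw [hM, hN]; linarith) h2
  have a1 : (N + r / 2) / d = (B + r) / d := by rw [hN]; ring
  have a2 : (N - r / 2) / d = B / d := by rw [hN]; ring
  have a3 : (M + r / 2) / d = 1 - B / d := by rw [hM, hN]; field_simp; ring
  have a4 : (M - r / 2) / d = 1 - (B + r) / d := by rw [hM, hN]; field_simp; ring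
  rw [a1, a2] at c1
  rw [a3, a4] at c2
  have b1 : 1 - N / d = M / d := by rw [hM]; field_simp
  unfold ringCost mainPot
  rw [← hN, b1, ← hM]
  have hlogR : Real.log ((r : ℝ) ^ 2 * d / (N * M)) =
      (2 : ℕ) * Real.log r + Real.log d - (Real.log N + Real.log M) := by
    rw [Real.log_div (by positivity) (by positivity), Real.log_mul (by positivity) (by positivity),
      Real.log_mul (by positivity) (by positivity), Real.log_pow]
  rw [hlogR]
  have hR : r ^ 3 / (24 * N) * (1 + 2 / 5 * η ^ 2) + r ^ 3 / (24 * M) * (1 + 2 / 5 * η ^ 2) =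
      r / 2 * (r ^ 2 * d / (N * M) / 12 * (1 + 2 / 5 * η ^ 2)) := by
    have hdNM : (d : ℝ) = N + M := by rw [hM]; ring
    rw [hdNM]
    field_simp
    ring
  have l1 : Real.log (N / d) = Real.log N - Real.log d := Real.log_div hN0.ne' hd.ne'
  have l2 : Real.log (M / d) = Real.log M - Real.log d := Real.log_div hM0.ne' hd.ne'
  rw [mul_add (r / 2 : ℝ), ← hR]
  have key : (r : ℝ) * (-Real.log r + (Real.log (N / d) + Real.log (M / d)) / 2) =
      - r / 2 * Real.log d + r / 2 *
        -((2 : ℕ) * Real.log r + Real.log d - (Real.log N + Real.log M)) := by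
    rw [l1, l2]
    push_cast
    ring
  push_cast at key ⊢
  linarith

theorem log_twelve_gt : (2.4837 : ℝ) < Real.log 12 := by
  have h3 : 19 * Real.log 2 ≤ 12 * Real.log 3 := by
    have : Real.log (2 ^ 19) ≤ Real.log (3 ^ 12) := Real.log_le_log (by norm_num) (by norm_num)
    rw [Real.log_pow, Real.log_pow] at this
    exact_mod_cast this
  have h12 : Real.log 12 = 2 * Real.log 2 + Real.log 3 := by
    rw [show (12 : ℝ) = 2 ^ 2 * 3 by norm_num, Real.log_mul (by norm_num) (by norm_num),
      Real.log_pow]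
    norm_num
  have := Real.log_two_gt_d9
  rw [h12]
  linarith

theorem bulk_bracket (s r Y : ℝ) (hs : 100000 ≤ s) (h1 : s ≤ r) (h2 : r ≤ s + 1)
    (hY1 : s ^ 2 / 12 - r ≤ Y) (hY2 : Y ≤ s ^ 2 / 12 + r) :
    -Real.log (r ^ 2 / Y) + r ^ 2 / Y / 12 * (1 + 2 / 5 * (1 / 100) ^ 2) ≤ -1.482 := by
  have hY : 0 < Y := by nlinarith
  set ρ := r ^ 2 / Y / 12 with hρ
  have hup : ρ ≤ 1.0003 := by
    rw [hρ, div_div, div_le_iff₀ (by positivity)]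
    nlinarith
  have hlo : 0.9997 ≤ ρ := by
    rw [hρ, div_div, le_div_iff₀ (by positivity)]
    nlinarith
  have e : r ^ 2 / Y = 12 * ρ := by rw [hρ]; ring
  rw [e, Real.log_mul (by norm_num) (by linarith)]
  have hlog := Real.one_sub_inv_le_log_of_pos (show 0 < ρ by linarith)
  have hinv : ρ⁻¹ ≤ 1.0004 := by
    rw [inv_le_comm₀ (by linarith) (by norm_num)]
    refine le_trans ?_ hlo
    norm_num
  have := log_twelve_gt
  nlinarith

theorem end_bracket (R : ℝ) (h1 : 1 / 4 ≤ R) (h2 : R ≤ 8) :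
    -Real.log R + R / 12 * (1 + 2 / 5 * 1 ^ 2) ≤ 2.5 := by
  have h4 : Real.log (1 / 4) ≤ Real.log R := Real.log_le_log (by norm_num) h1
  have : Real.log (1 / 4) = -(2 * Real.log 2) := by
    rw [show (1 / 4 : ℝ) = (2 ^ 2)⁻¹ by norm_num, Real.log_inv, Real.log_pow]
    norm_num
  have := Real.log_two_lt_d9
  linarith

/-- The full potential. -/
def fullPot (d : ℕ) (B : ℕ) : ℝ :=
  mainPot d B - B / 2 * Real.log d + (-1.482 * B + 4 * (min (B : ℝ) (2 * (d / 10000)) +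
    max ((B : ℝ) - (d - d / 10000)) 0)) / 2

theorem pot_bulk (d B r : ℕ) (c : ℝ)
    (h : ringCost d B r ≤ mainPot d (B + r) - mainPot d B - r / 2 * Real.log d + r / 2 * c)
    (hc : c ≤ -1.482) : ringCost d B r ≤ fullPot d (B + r) - fullPot d B := by
  unfold fullPot
  push_cast
  have m1 : min (B : ℝ) (2 * (d / 10000)) ≤ min ((B : ℝ) + r) (2 * (d / 10000)) := by
    gcongr; simp
  have m2 : max ((B : ℝ) - (d - d / 10000)) 0 ≤ max ((B : ℝ) + r - (d - d / 10000)) 0 := by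
    gcongr; simp
  have : (r : ℝ) / 2 * c ≤ r / 2 * -1.482 := by gcongr
  linarith

theorem pot_low (d B r : ℕ) (c : ℝ)
    (h : ringCost d B r ≤ mainPot d (B + r) - mainPot d B - r / 2 * Real.log d + r / 2 * c)
    (hc : c ≤ 2.5) (hB : (B : ℝ) + r ≤ 2 * (d / 10000)) :
    ringCost d B r ≤ fullPot d (B + r) - fullPot d B := by
  unfold fullPot
  push_cast
  have hr0 : (0 : ℝ) ≤ r := Nat.cast_nonneg r
  rw [min_eq_left (by linarith : (B : ℝ) ≤ 2 * (d / 10000)), min_eq_left hB]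
  have m2 : max ((B : ℝ) - (d - d / 10000)) 0 ≤ max ((B : ℝ) + r - (d - d / 10000)) 0 := by
    gcongr; simp
  have : (r : ℝ) / 2 * c ≤ r / 2 * 2.5 := by gcongr
  linarith

theorem pot_high (d B r : ℕ) (c : ℝ)
    (h : ringCost d B r ≤ mainPot d (B + r) - mainPot d B - r / 2 * Real.log d + r / 2 * c)
    (hc : c ≤ 2.5) (hB : (d : ℝ) - d / 10000 ≤ B) :
    ringCost d B r ≤ fullPot d (B + r) - fullPot d B := by
  unfold fullPot
  push_cast
  have hr0 : (0 : ℝ) ≤ r := Nat.cast_nonneg r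
  have m1 : min (B : ℝ) (2 * (d / 10000)) ≤ min ((B : ℝ) + r) (2 * (d / 10000)) := by
    gcongr; simp
  rw [max_eq_left (by linarith : (0:ℝ) ≤ (B : ℝ) - (d - d / 10000)),
    max_eq_left (by linarith : (0:ℝ) ≤ (B : ℝ) + r - (d - d / 10000))]
  have : (r : ℝ) / 2 * c ≤ r / 2 * 2.5 := by gcongr
  linarith

theorem exists_ring_size (d : ℕ) (hd : 10 ^ 16 ≤ d) (B : ℕ) (hB : B < d) :
    ∃ r, 1 ≤ r ∧ B + r ≤ d ∧ ringCost d B r ≤ fullPot d (B + r) - fullPot d B := by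
  have hdR : (10 : ℝ) ^ 16 ≤ d := by exact_mod_cast hd
  have hd0 : (0 : ℝ) < d := by linarith [show (0 : ℝ) < 10 ^ 16 by norm_num]
  have hB0 : (0 : ℝ) ≤ B := Nat.cast_nonneg _
  have hBd : (B : ℝ) + 1 ≤ d := by exact_mod_cast hB
  rcases lt_or_ge (B : ℝ) (d / 10000) with hlow | hlow
  · -- lower end
    set q := Nat.sqrt B with hq
    have q1 : q * q ≤ B := Nat.sqrt_le B
    have q2 : B < (q + 1) * (q + 1) := Nat.lt_succ_sqrt B
    have q1R : (q : ℝ) * q ≤ B := by exact_mod_cast q1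
    have q2R : (B : ℝ) ≤ (q + 1) * (q + 1) := by exact_mod_cast q2.le
    have q0 : (0 : ℝ) ≤ q := Nat.cast_nonneg q
    have hqB : (q : ℝ) ≤ (B + 1) / 2 := by nlinarith [sq_nonneg ((q : ℝ) - 1)]
    have hsum : (B : ℝ) + (q + 1 : ℕ) ≤ 2 * (d / 10000) := by push_cast; linarith
    have hle : B + (q + 1) ≤ d := by
      have : (B : ℝ) + (q + 1 : ℕ) ≤ d := by linarith
      exact_mod_cast this
    refine ⟨q + 1, by omega, hle, ?_⟩
    have hN0 : (0 : ℝ) < B + (q + 1 : ℕ) / 2 := by push_cast; positivity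
    have hM0 : (d : ℝ) / 2 ≤ d - (B + (q + 1 : ℕ) / 2) := by push_cast at hsum ⊢; linarith
    have hM1 : (d : ℝ) - (B + (q + 1 : ℕ) / 2) ≤ d := by linarith
    have hMp : (0 : ℝ) < d - (B + (q + 1 : ℕ) / 2) := by linarith
    refine pot_low d B (q + 1) _ (cost_bound d B (q + 1) (by omega) hle 1 _ _ rfl rfl ?_ ?_)
      (end_bracket _ ?_ ?_) hsum
    · push_cast; linarith
    · push_cast at hsum ⊢; linarith
    · rw [le_div_iff₀ (mul_pos hN0 hMp)]
      have : (1 / 4 : ℝ) * (B + (q + 1 : ℕ) / 2) ≤ ((q + 1 : ℕ) : ℝ) ^ 2 := by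
        push_cast; nlinarith
      calc (1 / 4 : ℝ) * ((B + (q + 1 : ℕ) / 2) * (d - (B + (q + 1 : ℕ) / 2)))
          = ((1 / 4 : ℝ) * (B + (q + 1 : ℕ) / 2)) * (d - (B + (q + 1 : ℕ) / 2)) := by ring
        _ ≤ ((q + 1 : ℕ) : ℝ) ^ 2 * d := by gcongr
    · rw [div_le_iff₀ (mul_pos hN0 hMp)]
      have : ((q + 1 : ℕ) : ℝ) ^ 2 ≤ 4 * (B + (q + 1 : ℕ) / 2) := by
        push_cast; nlinarith
      calc ((q + 1 : ℕ) : ℝ) ^ 2 * d ≤ (4 * (B + (q + 1 : ℕ) / 2)) *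
            (2 * (d - (B + (q + 1 : ℕ) / 2))) := by gcongr; linarith
        _ = _ := by ring
  rcases le_or_gt ((d : ℝ) - d / 10000) B with hhigh | hhigh
  · -- upper end
    obtain ⟨C, hC⟩ : ∃ C, d = B + C := ⟨d - B, by omega⟩
    have hC1 : 1 ≤ C := by omega
    have hCR : (d : ℝ) = B + C := by exact_mod_cast hC
    have hC1R : (1 : ℝ) ≤ C := by exact_mod_cast hC1
    set q := Nat.sqrt C with hq
    have q1 : q * q ≤ C := Nat.sqrt_le C
    have q2 : C < (q + 1) * (q + 1) := Nat.lt_succ_sqrt C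
    have hq1 : 1 ≤ q := Nat.sqrt_pos.mpr hC1
    have hqC : q ≤ C := Nat.sqrt_le_self C
    have q1R : (q : ℝ) * q ≤ C := by exact_mod_cast q1
    have q2R : (C : ℝ) ≤ (q + 1) * (q + 1) := by exact_mod_cast q2.le
    have q0 : (1 : ℝ) ≤ q := by exact_mod_cast hq1
    have hqCR : (q : ℝ) ≤ C := by exact_mod_cast hqC
    refine ⟨q, hq1, by omega, ?_⟩
    have hM0 : (C : ℝ) / 2 ≤ d - (B + q / 2) := by linarith
    have hM1 : (d : ℝ) - (B + q / 2) ≤ C := by linarith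
    have hN0 : (d : ℝ) / 2 ≤ B + q / 2 := by linarith
    have hN1 : (B : ℝ) + q / 2 ≤ d := by linarith
    have hMp : (0 : ℝ) < d - (B + q / 2) := by linarith
    have hNp : (0 : ℝ) < B + q / 2 := by linarith
    refine pot_high d B q _ (cost_bound d B q hq1 (by omega) 1 _ _ rfl rfl ?_ ?_)
      (end_bracket _ ?_ ?_) hhigh
    · linarith
    · linarith
    · rw [le_div_iff₀ (mul_pos hNp hMp)]
      have : (1 / 4 : ℝ) * (d - (B + q / 2)) ≤ (q : ℝ) ^ 2 := by nlinarith
      calc (1 / 4 : ℝ) * ((B + q / 2) * (d - (B + q / 2)))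
          = ((1 / 4 : ℝ) * (d - (B + q / 2))) * (B + q / 2) := by ring
        _ ≤ (q : ℝ) ^ 2 * d := by gcongr
    · rw [div_le_iff₀ (mul_pos hNp hMp)]
      have : (q : ℝ) ^ 2 ≤ 2 * (d - (B + q / 2)) := by nlinarith
      calc (q : ℝ) ^ 2 * d ≤ (2 * (d - (B + q / 2))) * (4 * (B + q / 2)) := by
            gcongr; linarith
        _ = _ := by ring
  · -- bulk
    set X : ℝ := B * (d - B) / d with hX
    set s : ℝ := √(12 * X) with hs
    have hXlow : (d : ℝ) / 20000 ≤ X := by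
      rw [hX, le_div_iff₀ hd0]
      nlinarith [mul_nonneg (sub_nonneg.mpr hlow) (sub_nonneg.mpr hhigh.le)]
    have hXup : X ≤ d / 4 := by
      rw [hX, div_le_iff₀ hd0]
      nlinarith [sq_nonneg ((d : ℝ) - 2 * B)]
    have hs2 : s ^ 2 = 12 * X := Real.sq_sqrt (by linarith)
    have hs0 : 0 ≤ s := Real.sqrt_nonneg _
    have hsl : 100000 ≤ s := by
      apply Real.le_sqrt_of_sq_le
      nlinarith
    have hsu : s ≤ d / 10 ^ 7 := by
      apply Real.sqrt_le_iff.mpr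
      refine ⟨by positivity, ?_⟩
      rw [div_pow, le_div_iff₀ (by positivity)]
      nlinarith
    set r := ⌈s⌉₊ with hr
    have hr1 : s ≤ r := Nat.le_ceil s
    have hr2 : (r : ℝ) ≤ s + 1 := (Nat.ceil_lt_add_one hs0).le
    have hrd : (r : ℝ) ≤ d / 10 ^ 7 * 2 := by linarith
    have hr1' : 1 ≤ r := by
      have : (1 : ℝ) ≤ r := by linarith
      exact_mod_cast this
    have hle : B + r ≤ d := by
      have : (B : ℝ) + r ≤ d := by linarith
      exact_mod_cast this
    refine ⟨r, hr1', hle, ?_⟩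
    have hNp : (0 : ℝ) < B + r / 2 := by positivity
    have hMp : (0 : ℝ) < d - (B + r / 2) := by linarith
    have hcb := cost_bound d B r hr1' hle (1 / 100) _ _ rfl rfl (by linarith) (by linarith)
    have hY : (r : ℝ) ^ 2 * d / ((B + r / 2) * (d - (B + r / 2))) =
        r ^ 2 / ((B + r / 2) * (d - (B + r / 2)) / d) := by field_simp
    rw [hY] at hcb
    refine pot_bulk d B r _ hcb (bulk_bracket s r _ hsl hr1 hr2 ?_ ?_)
    · rw [hs2, le_div_iff₀ hd0]
      have : (12 * X / 12 - r) * d = B * (d - B) - r * d := by rw [hX]; field_simp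
      rw [this]
      nlinarith
    · rw [hs2, div_le_iff₀ hd0]
      have : (12 * X / 12 + r) * d = B * (d - B) + r * d := by rw [hX]; field_simp
      rw [this]
      nlinarith

theorem exists_good_config (d : ℕ) (hd : 10 ^ 16 ≤ d) :
    ∃ x : Fin d → E3, (∀ i, x i ∈ riemannSphere) ∧ Function.Injective x ∧
      logEnergy x ≤ (d : ℝ) ^ 2 / 4 - d * Real.log d / 4 - 0.3700708 * d := by
  obtain ⟨S, hc, hS, hE⟩ := rings_of_potential d (fullPot d) (exists_ring_size d hd)
  obtain ⟨x, hx, hi, hxE⟩ := exists_of_rings d S hc hS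
  refine ⟨x, hx, hi, ?_⟩
  have hdR : (10 : ℝ) ^ 16 ≤ d := by exact_mod_cast hd
  have hd0 : (0 : ℝ) < d := by linarith [show (0 : ℝ) < 10 ^ 16 by norm_num]
  have e1 : fullPot d d = (d : ℝ) ^ 2 / 4 - d / 2 * Real.log d +
      (-1.482 * d + 4 * (2 * (d / 10000) + d / 10000)) / 2 := by
    unfold fullPot mainPot
    rw [min_eq_right (by linarith), max_eq_left (by linarith), div_self hd0.ne']
    simp [yLogInt]
    ring
  have e2 : fullPot d 0 = -(d : ℝ) ^ 2 / 4 := by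
    unfold fullPot mainPot
    rw [min_eq_left (by push_cast; positivity), max_eq_right (by push_cast; linarith)]
    simp [yLogInt]
    ring
  rw [← hxE, e1, e2] at hE
  linarith

theorem feketeC_upper : ∀ᶠ d : ℕ in atTop, feketeC d ≤ (-0.3700708 : ℝ) := by
  filter_upwards [eventually_ge_atTop (10 ^ 16)] with d hd
  obtain ⟨x, hx, hi, hE⟩ := exists_good_config d hd
  have hdR : (10 : ℝ) ^ 16 ≤ d := by exact_mod_cast hd
  have hd0 : (0 : ℝ) < d := by linarith [show (0 : ℝ) < 10 ^ 16 by norm_num]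
  have hmin : minEnergy d ≤ logEnergy x := by
    refine csInf_le ⟨(d : ℝ) ^ 2 / 4 - d / 4 - d * (harmonic d : ℝ) / 4, ?_⟩ ⟨x, hx, hi, rfl⟩
    rintro e ⟨y, hy, hyi, rfl⟩
    exact energy_lower y hy hyi
  unfold feketeC
  rw [div_le_iff₀ hd0]
  linarith

theorem feketeC_lower : ∀ᶠ d : ℕ in atTop, (-0.4375 : ℝ) ≤ feketeC d := by
  have h1 := Real.tendsto_harmonic_sub_log.eventually_lt_const
    (show Real.eulerMascheroniConstant < 3 / 4 by
      linarith [Real.eulerMascheroniConstant_lt_two_thirds])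
  filter_upwards [h1, eventually_ge_atTop (10 ^ 16)] with d hd hd16
  have hd0 : 0 < d := lt_of_lt_of_le (by norm_num) hd16
  have hdR : (0 : ℝ) < d := by exact_mod_cast hd0
  have hne : { e : ℝ | ∃ x : Fin d → E3,
      (∀ i, x i ∈ riemannSphere) ∧ Function.Injective x ∧ logEnergy x = e }.Nonempty := by
    obtain ⟨x, hx, hi, _⟩ := exists_good_config d hd16
    exact ⟨_, x, hx, hi, rfl⟩
  have : (d : ℝ) ^ 2 / 4 - d / 4 - d * (harmonic d : ℝ) / 4 ≤ minEnergy d := by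
    refine le_csInf hne ?_
    rintro e ⟨x, hx, hi, rfl⟩
    exact energy_lower x hx hi
  unfold feketeC
  rw [le_div_iff₀ hdR]
  nlinarith

/-- **Bounds for the minimal logarithmic energy** (Wagner, Rakhmanov–Saff–Zhou, Dubickas,
Brauchart): `−0.4375 ≤ liminf C_d` and `limsup C_d ≤ −0.3700708`. -/
theorem minimal_energy_bounds :
    (-0.4375 : ℝ) ≤ liminf feketeC atTop ∧ limsup feketeC atTop ≤ (-0.3700708 : ℝ) := by
  have hl := feketeC_lower
  have hu := feketeC_upper
  have bl : IsBoundedUnder (· ≥ ·) atTop feketeC := isBoundedUnder_of_eventually_ge hl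
  have bu : IsBoundedUnder (· ≤ ·) atTop feketeC := isBoundedUnder_of_eventually_le hu
  exact ⟨le_liminf_of_le bu.isCoboundedUnder_ge hl, limsup_le_of_le bl.isCoboundedUnder_le hu⟩

end
end

section
/- (Expected energy of random spherical points.) Let d ≥ 2 and let x_1,…,x_d be independent random points, each uniformly distributed (normalized surface measure) on S(1/2). Then almost surely the points are pairwise distinct, the energy E(x_1,…,x_d) is integrable, and its expected value equals d²/4 − d/4. -/
noncomputable section

open Metric MeasureTheory

/-- Center `(0,0,1/2)` of the Riemann sphere. -/
def rsCenter : E3 := (WithLp.equiv 2 (Fin 3 → ℝ)).symm ![0, 0, 1/2]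

/-- The uniform (normalized surface) probability measure on the unit sphere of `ℝ³`. -/
def unifSphereR3 : Measure (sphere (0 : E3) 1) :=
  (((volume : Measure E3).toSphere Set.univ)⁻¹) • (volume : Measure E3).toSphere

/-- The uniform probability measure on the Riemann sphere `S(1/2)` (the sphere of radius
`1/2` centered at `(0,0,1/2)`), as a measure on `ℝ³`: the image of the uniform measure on
the unit sphere under `x ↦ (0,0,1/2) + (1/2)·x`. -/
def unifRiemannSphere : Measure E3 :=
  Measure.map (fun x : E3 => rsCenter + (2⁻¹ : ℝ) • x)
    (Measure.map (fun x : sphere (0 : E3) 1 => (x : E3)) unifSphereR3)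

lemma aux_polar (F : ℝ → ENNReal) (hF : Measurable F) :
    ∫⁻ p : ℝ × ℝ, F (p.1 ^ 2 + p.2 ^ 2) = ENNReal.ofReal Real.pi * ∫⁻ s in Set.Ioi 0, F s := by
  have himg : (fun r : ℝ => r ^ 2) '' Set.Ioi 0 = Set.Ioi 0 := by
    ext s
    constructor
    · rintro ⟨r, hr, rfl⟩
      exact pow_pos (Set.mem_Ioi.1 hr) 2
    · intro hs
      exact ⟨Real.sqrt s, Real.sqrt_pos.2 hs, Real.sq_sqrt (le_of_lt hs)⟩
  have h1 : ∫⁻ s in Set.Ioi 0, F s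
      = ∫⁻ r in Set.Ioi (0:ℝ), ENNReal.ofReal |2 * r| * F (r ^ 2) := by
    conv_lhs => rw [← himg]
    refine lintegral_image_eq_lintegral_abs_deriv_mul measurableSet_Ioi ?_ ?_ F
    · intro x _
      simpa using (hasDerivAt_pow 2 x).hasDerivWithinAt
    · intro a ha b hb hab
      exact (pow_left_inj₀ (le_of_lt ha) (le_of_lt hb) two_ne_zero).1 hab
  rw [← lintegral_comp_polarCoord_symm, h1, polarCoord_target, Measure.volume_eq_prod,
    ← Measure.prod_restrict]
  have h2 : ∀ p : ℝ × ℝ, ENNReal.ofReal p.1 • F ((polarCoord.symm p).1 ^ 2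
      + (polarCoord.symm p).2 ^ 2) = ENNReal.ofReal p.1 * F (p.1 ^ 2) := by
    intro p
    simp only [polarCoord_symm_apply, smul_eq_mul]
    congr 2
    have := Real.sin_sq_add_cos_sq p.2
    linear_combination p.1 ^ 2 * this
  simp_rw [h2]
  rw [lintegral_prod _ (by fun_prop)]
  simp only [lintegral_const, MeasurableSet.univ, Measure.restrict_apply, Set.univ_inter,
    Real.volume_Ioo]
  rw [← lintegral_const_mul _ (by fun_prop)]
  refine setLIntegral_congr_fun measurableSet_Ioi fun r hr => ?_
  have hr : 0 < r := hr
  rw [abs_of_pos (by positivity), ENNReal.ofReal_mul (by norm_num),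
    show Real.pi - -Real.pi = 2 * Real.pi by ring, ENNReal.ofReal_mul (by norm_num)]
  ring

lemma aux_E3 (G : ℝ × ℝ → ENNReal) (hG : Measurable G) :
    ∫⁻ z : E3, G (z 0, ‖z‖ ^ 2)
      = ENNReal.ofReal Real.pi * ∫⁻ h, ∫⁻ s in Set.Ioi 0, G (h, h ^ 2 + s) := by
  have e1 := (PiLp.volume_preserving_toLp (Fin 3)).lintegral_comp_emb
    (MeasurableEquiv.toLp 2 (Fin 3 → ℝ)).measurableEmbedding (fun z : E3 => G (z 0, ‖z‖ ^ 2))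
  rw [← e1]
  have e2 := (volume_preserving_piFinSuccAbove (fun _ : Fin 3 => ℝ) 0).symm.lintegral_comp_emb
    (MeasurableEquiv.measurableEmbedding _) 
    (fun z : Fin 3 → ℝ => G ((WithLp.toLp 2 z : E3) 0, ‖(WithLp.toLp 2 z : E3)‖ ^ 2))
  rw [← e2, Measure.volume_eq_prod]
  simp only [EuclideanSpace.norm_sq_eq, Fin.sum_univ_three, MeasurableEquiv.piFinSuccAbove_symm_apply]
  rw [lintegral_prod _ (by
    simp only [Fin.insertNthEquiv, Equiv.coe_fn_mk]
    fun_prop)]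
  rw [← lintegral_const_mul _ (Measurable.lintegral_prod_right' (f := fun p : ℝ × ℝ => G (p.1, p.1 ^ 2 + p.2)) (by fun_prop))]
  congr 1
  ext h
  rw [← aux_polar _ (by fun_prop)]
  have e3 := (volume_preserving_finTwoArrow ℝ).lintegral_comp_emb
    (MeasurableEquiv.measurableEmbedding _) (fun p : ℝ × ℝ => G (h, h^2 + (p.1 ^ 2 + p.2 ^ 2)))
  rw [← e3]
  congr 1
  ext p
  simp only [Fin.insertNthEquiv, Equiv.coe_fn_mk, Fin.insertNth_zero', Real.norm_eq_abs, sq_abs,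
    MeasurableEquiv.finTwoArrow_apply]
  change G (h, h ^ 2 + p 0 ^ 2 + p 1 ^ 2) = _
  rw [add_assoc]

lemma aux_sector0 (A : Set ℝ) (hA : MeasurableSet A) :
    volume {z : E3 | 0 < ‖z‖ ^ 2 ∧ ‖z‖ ^ 2 < 1 ∧ z 0 / √(‖z‖ ^ 2) ∈ A}
      = ENNReal.ofReal Real.pi * (ENNReal.ofReal (2 / 3) * volume (A ∩ Set.Ioo (-1) 1)) := by
  set T : Set (ℝ × ℝ) := {q | 0 < q.2 ∧ q.2 < 1 ∧ q.1 / √q.2 ∈ A} with hT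
  have hTm : MeasurableSet T := by
    refine (measurableSet_lt measurable_const measurable_snd).inter
      ((measurableSet_lt measurable_snd measurable_const).inter ?_)
    exact (show Measurable fun q : ℝ × ℝ => q.1 / √q.2 by fun_prop) hA
  have hGm : Measurable (T.indicator (1 : ℝ × ℝ → ENNReal)) := measurable_one.indicator hTm
  have hf : Measurable fun z : E3 => (z 0, ‖z‖ ^ 2) := by fun_prop
  have h0 : {z : E3 | 0 < ‖z‖ ^ 2 ∧ ‖z‖ ^ 2 < 1 ∧ z 0 / √(‖z‖ ^ 2) ∈ A}
      = (fun z : E3 => (z 0, ‖z‖ ^ 2)) ⁻¹' T := rfl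
  rw [h0, ← lintegral_indicator_one (hf hTm)]
  change ∫⁻ z : E3, T.indicator (1 : ℝ × ℝ → ENNReal) (z 0, ‖z‖ ^ 2) = _
  rw [aux_E3 _ hGm]
  congr 1
  set K : ℝ × ℝ → ENNReal := fun q =>
    (Set.Ioi (0:ℝ)).indicator (1 : ℝ → ENNReal) (q.2 - q.1 ^ 2) * T.indicator 1 q with hK
  have hKm : Measurable K := by
    refine Measurable.mul ?_ hGm
    exact (measurable_one.indicator measurableSet_Ioi).comp (by fun_prop)
  have h1 : ∀ h : ℝ, ∫⁻ s in Set.Ioi 0, T.indicator (1 : ℝ × ℝ → ENNReal) (h, h ^ 2 + s)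
      = ∫⁻ u, K (h, u) := by
    intro h
    rw [← lintegral_add_left_eq_self (fun u => K (h, u)) (h ^ 2), ← lintegral_indicator measurableSet_Ioi]
    congr 1
    ext s
    simp only [hK, add_sub_cancel_left]
    by_cases hs : s ∈ Set.Ioi (0:ℝ) <;> simp [hs]
  simp_rw [h1]
  rw [lintegral_lintegral_swap (f := fun h u => K (h, u)) hKm.aemeasurable]
  have h2 : ∀ u : ℝ, ∫⁻ h, K (h, u) = (Set.Ioo (0:ℝ) 1).indicator
      (fun u => ENNReal.ofReal (√u) * volume (A ∩ Set.Ioo (-1) 1)) u := by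
    intro u
    by_cases hu : u ∈ Set.Ioo (0:ℝ) 1
    · have hs : 0 < √u := Real.sqrt_pos.2 hu.1
      rw [Set.indicator_of_mem hu]
      have hset : ∀ h, K (h, u)
          = ((fun x => x * (√u)⁻¹) ⁻¹' (A ∩ Set.Ioo (-1) 1)).indicator 1 h := by
        intro h
        have hiff : 0 < u - h ^ 2 ↔ (-1 < h / √u ∧ h / √u < 1) := by
          rw [lt_div_iff₀ hs, div_lt_iff₀ hs, one_mul, neg_one_mul, ← abs_lt, sub_pos,
            Real.lt_sqrt (abs_nonneg _), sq_abs]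
        have hT' : (h, u) ∈ T ↔ h / √u ∈ A := ⟨fun hh => hh.2.2, fun h4 => ⟨hu.1, hu.2, h4⟩⟩
        have hR : h ∈ (fun x => x * (√u)⁻¹) ⁻¹' (A ∩ Set.Ioo (-1) 1) ↔ (h, u) ∈ T ∧ 0 < u - h ^ 2 := by
          rw [hT', hiff, div_eq_mul_inv]
          rfl
        by_cases h3 : 0 < u - h ^ 2 <;> by_cases h4 : (h, u) ∈ T
        · rw [Set.indicator_of_mem (hR.2 ⟨h4, h3⟩)]
          simp only [hK]
          rw [Set.indicator_of_mem h4, Set.indicator_of_mem (Set.mem_Ioi.2 h3)]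
          simp
        · rw [Set.indicator_of_notMem fun hh => h4 (hR.1 hh).1]
          simp only [hK]
          rw [Set.indicator_of_notMem h4, mul_zero]
        · rw [Set.indicator_of_notMem fun hh => h3 (hR.1 hh).2]
          simp only [hK]
          rw [Set.indicator_of_notMem (fun hh => h3 (Set.mem_Ioi.1 hh)), zero_mul]
        · rw [Set.indicator_of_notMem fun hh => h3 (hR.1 hh).2]
          simp only [hK]
          rw [Set.indicator_of_notMem h4, mul_zero]
      simp_rw [hset]
      rw [lintegral_indicator_one ((hA.inter measurableSet_Ioo).preimage (by fun_prop)),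
        Real.volume_preimage_mul_right (inv_ne_zero hs.ne'), inv_inv, abs_of_pos hs]
    · rw [Set.indicator_of_notMem hu]
      have : ∀ h, K (h, u) = 0 := by
        intro h
        have : (h, u) ∉ T := fun hh => hu ⟨hh.1, hh.2.1⟩
        simp [hK, this]
      simp [this]
  simp_rw [h2]
  rw [lintegral_indicator measurableSet_Ioo, lintegral_mul_const _ (by fun_prop)]
  congr 1
  rw [Measure.restrict_congr_set Ioo_ae_eq_Ioc, ← ofReal_integral_eq_lintegral_ofReal,
    ← intervalIntegral.integral_of_le zero_le_one]
  · congr 1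
    simp_rw [Real.sqrt_eq_rpow]
    rw [integral_rpow (by norm_num)]
    norm_num
  · exact (Real.continuous_sqrt.intervalIntegrable 0 1).1
  · exact Filter.Eventually.of_forall fun x => Real.sqrt_nonneg x

lemma aux_sector (y : E3) (hy : ‖y‖ = 1) (A : Set ℝ) (hA : MeasurableSet A) :
    volume {z : E3 | 0 < ‖z‖ ^ 2 ∧ ‖z‖ ^ 2 < 1 ∧ inner ℝ y z / √(‖z‖ ^ 2) ∈ A}
      = ENNReal.ofReal Real.pi * (ENNReal.ofReal (2 / 3) * volume (A ∩ Set.Ioo (-1) 1)) := by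
  obtain ⟨b, hb⟩ := Orthonormal.exists_orthonormalBasis_extension_of_card_eq (𝕜 := ℝ) (E := E3)
    (ι := Fin 3) (by simp) (v := fun _ => y) (s := {0})
    ⟨fun i => by simpa using hy, fun i j hij => absurd (Subsingleton.elim i j) hij⟩
  have hb0 : b 0 = y := hb 0 rfl
  rw [← aux_sector0 A hA]
  have hm := b.measurePreserving_measurableEquiv.measure_preimage_equiv
    {z : E3 | 0 < ‖z‖ ^ 2 ∧ ‖z‖ ^ 2 < 1 ∧ z 0 / √(‖z‖ ^ 2) ∈ A}
  rw [← hm]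
  congr 1
  ext z
  simp [OrthonormalBasis.repr_apply_apply, hb0, OrthonormalBasis.measurableEquiv]

open scoped Pointwise in
lemma aux_toSphere (y : E3) (hy : ‖y‖ = 1) (A : Set ℝ) (hA : MeasurableSet A) :
    (volume : Measure E3).toSphere {x | inner ℝ y (x : E3) ∈ A}
      = ENNReal.ofReal (2 * Real.pi) * volume (A ∩ Set.Ioo (-1) 1) := by
  rw [Measure.toSphere_apply' _ (show MeasurableSet {x : sphere (0 : E3) 1 | inner ℝ y (x : E3) ∈ A} from
    (show Measurable fun x : sphere (0 : E3) 1 => inner ℝ y (x : E3) by fun_prop) hA)]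
  have hset : (Set.Ioo (0 : ℝ) 1 • (Subtype.val '' {x : sphere (0 : E3) 1 | inner ℝ y (x : E3) ∈ A}) : Set E3)
      = {z : E3 | 0 < ‖z‖ ^ 2 ∧ ‖z‖ ^ 2 < 1 ∧ inner ℝ y z / √(‖z‖ ^ 2) ∈ A} := by
    ext z
    rw [Set.mem_smul]
    constructor
    · rintro ⟨r, hr, _, ⟨x, hx, rfl⟩, rfl⟩
      have hx1 : ‖(x : E3)‖ = 1 := by simpa using x.2
      have h0 : (0:ℝ) < r := hr.1
      have hn : ‖r • (x : E3)‖ = r := by rw [norm_smul, hx1, Real.norm_of_nonneg h0.le, mul_one]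
      refine ⟨?_, ?_, ?_⟩
      · rw [hn]; positivity
      · rw [hn]; nlinarith [hr.2]
      · rw [hn, Real.sqrt_sq h0.le, inner_smul_right, mul_div_cancel_left₀ _ h0.ne']
        exact hx
    · rintro ⟨h1, h2, h3⟩
      have hz : 0 < ‖z‖ := by
        rcases (norm_nonneg z).eq_or_lt with h | h
        · rw [← h] at h1; norm_num at h1
        · exact h
      rw [Real.sqrt_sq hz.le] at h3
      refine ⟨‖z‖, ⟨hz, by nlinarith⟩, ‖z‖⁻¹ • z, ⟨⟨‖z‖⁻¹ • z, ?_⟩, ?_, rfl⟩, ?_⟩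
      · simp [norm_smul, hz.ne']
      · simp only [Set.mem_ofPred_eq, inner_smul_right]
        rwa [div_eq_inv_mul] at h3
      · rw [smul_smul, mul_inv_cancel₀ hz.ne', one_smul]
  rw [hset, aux_sector y hy A hA, ← mul_assoc, ← mul_assoc]
  congr 1
  rw [finrank_euclideanSpace, Fintype.card_fin, ← ENNReal.ofReal_natCast,
    ← ENNReal.ofReal_mul (by positivity), ← ENNReal.ofReal_mul (by positivity)]
  congr 1
  push_cast
  ring

lemma aux_univ : (volume : Measure E3).toSphere Set.univ = ENNReal.ofReal (4 * Real.pi) := by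
  have := aux_toSphere (EuclideanSpace.single 0 1) (by simp) Set.univ MeasurableSet.univ
  simp only [Set.mem_univ, Set.ofPred_true, Set.univ_inter, Real.volume_Ioo] at this
  rw [this, ← ENNReal.ofReal_mul (by positivity)]
  congr 1
  ring

instance aux_prob : IsProbabilityMeasure unifSphereR3 := by
  constructor
  rw [unifSphereR3, Measure.smul_apply, smul_eq_mul, aux_univ]
  exact ENNReal.inv_mul_cancel (by simp [Real.pi_pos]) ENNReal.ofReal_ne_top

lemma aux_arch (y : E3) (hy : ‖y‖ = 1) :
    Measure.map (fun x : sphere (0 : E3) 1 => inner ℝ y (x : E3)) unifSphereR3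
      = ENNReal.ofReal (1 / 2) • (volume.restrict (Set.Ioo (-1) 1)) := by
  ext A hA
  rw [Measure.map_apply (by fun_prop) hA, unifSphereR3, Measure.smul_apply, Measure.smul_apply,
    smul_eq_mul, smul_eq_mul, Measure.restrict_apply hA, aux_univ]
  change _ * (volume : Measure E3).toSphere {x | inner ℝ y (x : E3) ∈ A} = _
  rw [aux_toSphere y hy A hA, ← mul_assoc]
  congr 1
  have := Real.pi_pos
  rw [← ENNReal.ofReal_inv_of_pos (by positivity), ← ENNReal.ofReal_mul (by positivity)]
  congr 1
  field_simp
  norm_num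

/-- The affine parametrization of the Riemann sphere by the unit sphere. -/
def auxPsi (x : sphere (0 : E3) 1) : E3 := rsCenter + (2⁻¹ : ℝ) • (x : E3)

lemma aux_psi_meas : Measurable auxPsi := by
  unfold auxPsi
  fun_prop

lemma aux_riemann : unifRiemannSphere = Measure.map auxPsi unifSphereR3 := by
  rw [unifRiemannSphere, Measure.map_map (by fun_prop) (by fun_prop)]
  rfl

instance aux_prob' : IsProbabilityMeasure unifRiemannSphere := by
  rw [aux_riemann]
  exact Measure.isProbabilityMeasure_map aux_psi_meas.aemeasurable

/-- The log-distance as a function of the inner product. -/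
def auxK (t : ℝ) : ℝ := 2⁻¹ * Real.log (1 / 2 - t / 2)

lemma aux_K_meas : Measurable auxK := by
  unfold auxK
  fun_prop

lemma aux_log_dist (x y : sphere (0 : E3) 1) :
    Real.log (dist (auxPsi y) (auxPsi x)) = auxK (inner ℝ (y : E3) (x : E3)) := by
  have hx : ‖(x : E3)‖ = 1 := by simpa using x.2
  have hy : ‖(y : E3)‖ = 1 := by simpa using y.2
  have h1 : dist (auxPsi y) (auxPsi x) ^ 2 = 1 / 2 - inner ℝ (y : E3) (x : E3) / 2 := by
    rw [auxPsi, auxPsi, dist_add_left, dist_eq_norm, ← smul_sub, norm_smul, mul_pow,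
      norm_sub_sq_real, hx, hy]
    norm_num
    ring
  rw [auxK, ← h1, Real.log_pow]
  push_cast
  ring

lemma aux_K_int : IntervalIntegrable auxK volume (-1) 1 := by
  have h := (intervalIntegral.intervalIntegrable_log' (a := 0) (b := 1))
  have h2 := (h.comp_mul_left (c := 1 / 2)).comp_sub_left 1
  norm_num at h2
  have h3 := h2.symm.const_mul 2⁻¹
  refine h3.congr ?_
  intro t _
  simp only [auxK]
  congr 2
  ring

lemma aux_K_val : ∫ t in (-1)..1, auxK t = -1 := by
  simp only [auxK]
  rw [intervalIntegral.integral_const_mul,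
    intervalIntegral.integral_comp_sub_div (fun u => Real.log u) (two_ne_zero)]
  norm_num

lemma aux_K_integrable : Integrable auxK
    (ENNReal.ofReal (1 / 2) • (volume.restrict (Set.Ioo (-1) 1))) := by
  refine Integrable.smul_measure ?_ ENNReal.ofReal_ne_top
  exact aux_K_int.1.mono_set Set.Ioo_subset_Ioc_self

lemma aux_K_integral : ∫ t, auxK t ∂(ENNReal.ofReal (1 / 2) • (volume.restrict (Set.Ioo (-1) 1)))
    = -(1 / 2) := by
  rw [integral_smul_measure, Measure.restrict_congr_set Ioo_ae_eq_Ioc,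
    ← intervalIntegral.integral_of_le (by norm_num), aux_K_val]
  norm_num

lemma aux_prod_integrable : Integrable (fun p : E3 × E3 => Real.log (dist p.1 p.2))
    (unifRiemannSphere.prod unifRiemannSphere) := by
  have hm : Measurable (fun p : E3 × E3 => Real.log (dist p.1 p.2)) := by fun_prop
  rw [aux_riemann, Measure.map_prod_map _ _ aux_psi_meas aux_psi_meas,
    integrable_map_measure hm.aestronglyMeasurable
      (aux_psi_meas.prodMap aux_psi_meas).aemeasurable,
    integrable_prod_iff
      (hm.comp (aux_psi_meas.prodMap aux_psi_meas)).aestronglyMeasurable]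
  simp only [Function.comp_def, Prod.map_apply, aux_log_dist]
  have hn : ∀ y : sphere (0 : E3) 1, ‖(y : E3)‖ = 1 := fun y => by simpa using y.2
  constructor
  · refine Filter.Eventually.of_forall fun y => ?_
    have := aux_K_integrable
    rw [← aux_arch y (hn y)] at this
    exact this.comp_measurable (by fun_prop)
  · have : ∀ y : sphere (0 : E3) 1,
        ∫ x : sphere (0 : E3) 1, ‖auxK (inner ℝ (y : E3) (x : E3))‖ ∂unifSphereR3
        = ∫ t, ‖auxK t‖ ∂(ENNReal.ofReal (1 / 2) • (volume.restrict (Set.Ioo (-1) 1))) := by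
      intro y
      rw [← aux_arch y (hn y), integral_map (by fun_prop)
        aux_K_meas.norm.aestronglyMeasurable]
    simp_rw [this]
    exact integrable_const _

lemma aux_prod_integral : ∫ p : E3 × E3, Real.log (dist p.1 p.2)
    ∂(unifRiemannSphere.prod unifRiemannSphere) = -(1 / 2) := by
  have hm : Measurable (fun p : E3 × E3 => Real.log (dist p.1 p.2)) := by fun_prop
  have hn : ∀ y : sphere (0 : E3) 1, ‖(y : E3)‖ = 1 := fun y => by simpa using y.2
  rw [integral_prod _ aux_prod_integrable, aux_riemann]
  rw [integral_map aux_psi_meas.aemeasurable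
    (by exact hm.stronglyMeasurable.integral_prod_right'.aestronglyMeasurable)]
  have : ∀ y : sphere (0 : E3) 1, ∫ q, Real.log (dist (auxPsi y) q)
      ∂(Measure.map auxPsi unifSphereR3) = -(1 / 2) := by
    intro y
    rw [integral_map aux_psi_meas.aemeasurable
      (show Measurable fun q => Real.log (dist (auxPsi y) q) by fun_prop).aestronglyMeasurable]
    simp_rw [aux_log_dist]
    rw [← aux_K_integral, ← aux_arch y (hn y), integral_map (by fun_prop)
        aux_K_meas.aestronglyMeasurable]
  simp_rw [this]
  simp

lemma aux_prod_diag : (unifRiemannSphere.prod unifRiemannSphere) {p | p.1 = p.2} = 0 := by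
  have hD : MeasurableSet {p : E3 × E3 | p.1 = p.2} := measurableSet_eq_fun measurable_fst measurable_snd
  have hn : ∀ y : sphere (0 : E3) 1, ‖(y : E3)‖ = 1 := fun y => by simpa using y.2
  rw [aux_riemann, Measure.map_prod_map _ _ aux_psi_meas aux_psi_meas,
    Measure.map_apply (aux_psi_meas.prodMap aux_psi_meas) hD,
    Measure.measure_prod_null (hD.preimage (aux_psi_meas.prodMap aux_psi_meas))]
  refine Filter.Eventually.of_forall fun y => ?_
  have h0 : Measure.map (fun x : sphere (0 : E3) 1 => inner ℝ (y : E3) (x : E3)) unifSphereR3 {1}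
      = 0 := by
    rw [aux_arch y (hn y)]
    simp
  rw [Measure.map_apply (by fun_prop) (measurableSet_singleton 1)] at h0
  refine measure_mono_null ?_ h0
  intro x hx
  have hx' : rsCenter + (2⁻¹ : ℝ) • (y : E3) = rsCenter + (2⁻¹ : ℝ) • (x : E3) := hx
  have hxy : (y : E3) = x := smul_right_injective E3 (by norm_num : (2⁻¹ : ℝ) ≠ 0)
    (add_left_cancel hx')
  simp [← hxy, hn y]

lemma aux_pair (d : ℕ) (i j : Fin d) (hij : i ≠ j) :
    MeasurePreserving (fun x : Fin d → E3 => (x i, x j))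
      (Measure.pi fun _ : Fin d => unifRiemannSphere)
      (unifRiemannSphere.prod unifRiemannSphere) := by
  refine ⟨by fun_prop, ?_⟩
  have h := ProbabilityTheory.iIndepFun_pi (μ := fun _ : Fin d => unifRiemannSphere)
    (X := fun _ => (id : E3 → E3)) (fun _ => aemeasurable_id)
  have h2 := (h.indepFun hij).map_prod_eq_prod_map_map
    (measurable_pi_apply i).aemeasurable (measurable_pi_apply j).aemeasurable
  refine Eq.trans h2 ?_
  have he : ∀ k : Fin d, Measure.map (fun x : Fin d → E3 => x k)
      (Measure.pi fun _ : Fin d => unifRiemannSphere) = unifRiemannSphere :=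
    fun k => (measurePreserving_eval (fun _ : Fin d => unifRiemannSphere) k).map_eq
  exact congrArg₂ Measure.prod (he i) (he j)

lemma aux_card (d : ℕ) :
    ((Finset.univ.filter (fun p : Fin d × Fin d => p.1 < p.2)).card : ℝ)
      = (d : ℝ) * (d - 1) / 2 := by
  have h : (Finset.univ.filter (fun p : Fin d × Fin d => p.1 < p.2)).card = d.choose 2 := by
    simpa using Fintype.card_product_filter_lt (α := Fin d)
  rw [h, Nat.cast_choose_two]

/-- **Expected energy of random spherical points**: for `x_1,…,x_d` independent uniform
points on `S(1/2)`, almost surely the points are pairwise distinct, the logarithmic energy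
is integrable, and its expected value is `d²/4 − d/4`. -/
theorem expected_energy_random_points (d : ℕ) (hd : 2 ≤ d) :
    (Measure.pi fun _ : Fin d => unifRiemannSphere) { x | ¬ Function.Injective x } = 0 ∧
    Integrable logEnergy (Measure.pi fun _ : Fin d => unifRiemannSphere) ∧
    ∫ x, logEnergy x ∂(Measure.pi fun _ : Fin d => unifRiemannSphere)
      = (d : ℝ) ^ 2 / 4 - (d : ℝ) / 4 := by
  have hint : ∀ p ∈ Finset.univ.filter (fun p : Fin d × Fin d => p.1 < p.2),
      Integrable (fun x : Fin d → E3 => Real.log (dist (x p.1) (x p.2)))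
        (Measure.pi fun _ : Fin d => unifRiemannSphere) := by
    intro p hp
    have hp' : p.1 < p.2 := by simpa using hp
    exact (aux_pair d p.1 p.2 hp'.ne).integrable_comp_of_integrable aux_prod_integrable
  refine ⟨?_, ?_, ?_⟩
  · have hsub : { x : Fin d → E3 | ¬ Function.Injective x }
        ⊆ ⋃ p : {p : Fin d × Fin d // p.1 ≠ p.2},
          (fun x : Fin d → E3 => (x p.1.1, x p.1.2)) ⁻¹' {q | q.1 = q.2} := by
      intro x hx
      simp only [Set.mem_ofPred_eq, Function.Injective, not_forall] at hx
      obtain ⟨i, j, h1, h2⟩ := hx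
      exact Set.mem_iUnion.2 ⟨⟨(i, j), h2⟩, h1⟩
    refine measure_mono_null hsub (measure_iUnion_null fun p => ?_)
    rw [(aux_pair d p.1.1 p.1.2 p.2).measure_preimage
      (measurableSet_eq_fun measurable_fst measurable_snd).nullMeasurableSet]
    exact aux_prod_diag
  · unfold logEnergy
    exact (integrable_finsetSum _ hint).neg
  · unfold logEnergy
    rw [integral_neg, integral_finsetSum _ hint]
    have : ∀ p ∈ Finset.univ.filter (fun p : Fin d × Fin d => p.1 < p.2),
        ∫ x : Fin d → E3, Real.log (dist (x p.1) (x p.2))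
          ∂(Measure.pi fun _ : Fin d => unifRiemannSphere) = -(1 / 2) := by
      intro p hp
      have hp' : p.1 < p.2 := by simpa using hp
      have hmp := aux_pair d p.1 p.2 hp'.ne
      rw [← aux_prod_integral, ← hmp.map_eq, integral_map hmp.measurable.aemeasurable
        (show Measurable fun p : E3 × E3 => Real.log (dist p.1 p.2) by
          fun_prop).aestronglyMeasurable]
    rw [Finset.sum_congr rfl this, Finset.sum_const, nsmul_eq_mul, aux_card]
    ring


end
end
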